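/- Let T be an r-row rectangular fluctuating tableau with t := Σ_j |c_j| ≥ 1. For every 1 ≤ i ≤ r−1, prom_i(T) is a fixed-point-free permutation of {1,…,t}. Moreover, if r is even, then prom_{r/2}(T) is a fixed-point-free involution. -/

import Mathlib

open scoped Classical

noncomputable section

namespace FT

/-- A (raw) `r`-row integer vector; generalized partitions are the antitone ones. -/
abbrev GP (r : ℕ) := Fin r → ℤ

/-- The weakly decreasing rearrangement of a tuple. -/
def sortDesc {r : ℕ} (α : GP r) : GP r := fun i => (α ∘ Tuple.sort α) i.rev

/-- Standard basis vector (0-indexed). -/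
def eV {r : ℕ} (a : Fin r) : GP r := fun i => if i = a then 1 else 0

/-- Standard basis vector with 1-indexed row `a` (zero if out of range). -/
def eN (r : ℕ) (a : ℕ) : GP r := fun i => if (i : ℕ) + 1 = a then 1 else 0

/-- Indicator vector of a set of rows. -/
def indV {r : ℕ} (S : Finset (Fin r)) : GP r := fun i => if i ∈ S then 1 else 0

/-- `colStep r c μ λ`: `λ` is obtained from `μ` by adding (if `c ≥ 0`) or removing
(if `c ≤ 0`) a skew column of `|c|` boxes. -/
def colStep (r : ℕ) (c : ℤ) (μ lam : GP r) : Prop :=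
  ∃ S : Finset (Fin r), S.card = c.natAbs ∧
    (if 0 ≤ c then lam = μ + indV S else lam = μ - indV S)

/-- Skew fluctuating tableau of length `n` and type `c` (recorded at indices `0,…,n`;
values of `T` and `c` beyond those indices are irrelevant). -/
def IsSkewFT (r n : ℕ) (T : ℕ → GP r) (c : ℕ → ℤ) : Prop :=
  (∀ k ≤ n, Antitone (T k)) ∧ ∀ j < n, colStep r (c j) (T j) (T (j + 1))

/-- (Non-skew) fluctuating tableau: starts at the empty shape. -/
def IsFT (r n : ℕ) (T : ℕ → GP r) (c : ℕ → ℤ) : Prop :=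
  IsSkewFT r n T c ∧ T 0 = 0

/-- Rectangular: the final shape is constant. -/
def Rect (r n : ℕ) (T : ℕ → GP r) : Prop := ∃ m : ℤ, ∀ i, T n i = m

/-- Bender–Knuth involution `BK_i` (for `1 ≤ i ≤ n-1`). -/
def BK {r : ℕ} (i : ℕ) (T : ℕ → GP r) : ℕ → GP r :=
  fun k => if k = i then sortDesc (T (i + 1) + T (i - 1) - T i) else T k

/-- `BKseg a m = BK (a+m-1) ∘ ⋯ ∘ BK a` (apply `BK a` first). -/
def BKseg {r : ℕ} (a : ℕ) : ℕ → (ℕ → GP r) → ℕ → GP r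
  | 0 => id
  | m + 1 => BK (a + m) ∘ BKseg a m

/-- Promotion `P = BK_{n-1} ∘ ⋯ ∘ BK_1` on length-`n` tableaux. -/
def promo {r : ℕ} (n : ℕ) (T : ℕ → GP r) : ℕ → GP r := BKseg 1 (n - 1) T

/-- `BKsegRev a m = BK a ∘ ⋯ ∘ BK (a+m-1)` (apply `BK (a+m-1)` first). -/
def BKsegRev {r : ℕ} (a : ℕ) : ℕ → (ℕ → GP r) → ℕ → GP r
  | 0 => id
  | m + 1 => BKsegRev a m ∘ BK (a + m)

/-- Inverse of promotion: `P⁻¹ = BK_1 ∘ ⋯ ∘ BK_{n-1}`. -/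
def promoInv {r : ℕ} (n : ℕ) (T : ℕ → GP r) : ℕ → GP r := BKsegRev 1 (n - 1) T

def evacAux {r : ℕ} : ℕ → (ℕ → GP r) → ℕ → GP r
  | 0, T => T
  | m + 1, T => evacAux m (BKseg 1 (m + 1) T)

/-- Evacuation `E = BK_1 ∘ (BK_2∘BK_1) ∘ ⋯ ∘ (BK_{n-1}∘⋯∘BK_1)`. -/
def evac {r : ℕ} (n : ℕ) (T : ℕ → GP r) : ℕ → GP r := evacAux (n - 1) T

def devacAux {r : ℕ} (n : ℕ) : ℕ → (ℕ → GP r) → ℕ → GP r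
  | 0, T => T
  | m + 1, T => BKseg (n - (m + 1)) (m + 1) (devacAux n m T)

/-- Dual evacuation `E* = (BK_{n-1}∘⋯∘BK_1) ∘ (BK_{n-1}∘⋯∘BK_2) ∘ ⋯ ∘ BK_{n-1}`. -/
def devac {r : ℕ} (n : ℕ) (T : ℕ → GP r) : ℕ → GP r := devacAux n (n - 1) T

/-- `rev(-v)`. -/
def revNeg {r : ℕ} (v : GP r) : GP r := fun i => - v i.rev

/-- Time reversal `τ`. -/
def tauT {r : ℕ} (n : ℕ) (T : ℕ → GP r) : ℕ → GP r := fun k => T (n - k)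

/-- `ϖ`. -/
def varpiT {r : ℕ} (T : ℕ → GP r) : ℕ → GP r := fun k => revNeg (T k)

/-- `ε`. -/
def epsT {r : ℕ} (n : ℕ) (T : ℕ → GP r) : ℕ → GP r := fun k => revNeg (T (n - k))

/-- Sign of the `j`-th step of `T` (paper indexing: step `j` goes from `λ^{j-1}` to `λ^j`). -/
def sgnStep {r : ℕ} (T : ℕ → GP r) (j : ℕ) : ℤ :=
  if T j = T (j - 1) then 0 else if T (j - 1) ≤ T j then 1 else -1

/-- The switch involution `toggle_j` (paper indexing, `1 ≤ j ≤ n`). -/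
def toggleT {r : ℕ} (j : ℕ) (T : ℕ → GP r) : ℕ → GP r :=
  fun m => if m < j then T m else fun i => T m i - sgnStep T j

/-- Number of boxes added/removed in the step from `T j` to `T (j+1)`. -/
def stepSize {r : ℕ} (T : ℕ → GP r) (j : ℕ) : ℕ :=
  (Finset.univ.filter fun i : Fin r => T (j + 1) i ≠ T j i).card

/-- Cumulative step sizes: position of `T j` inside the oscillization. -/
def cum {r : ℕ} (T : ℕ → GP r) (j : ℕ) : ℕ := ∑ j' ∈ Finset.range j, stepSize T j'

/-- The `j`-th intermediate shape of the oscillization of the skew-column step `μ → λ`: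
boxes are added smallest-row-first and removed largest-row-first. -/
def oscStep {r : ℕ} (μ lam : GP r) (j : ℕ) : GP r := fun i =>
  let S := Finset.univ.filter fun i' : Fin r => lam i' ≠ μ i'
  if i ∈ S ∧ (if μ i < lam i then (S.filter fun i' => i' ≤ i).card ≤ j
              else (S.filter fun i' => i ≤ i').card ≤ j)
  then lam i else μ i

/-- Largest index `j ≤ n` with `cum T j ≤ k`. -/
def stdIdx {r : ℕ} (n : ℕ) (T : ℕ → GP r) (k : ℕ) : ℕ :=
  ((Finset.range (n + 1)).filter fun j => cum T j ≤ k).sup id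

/-- The oscillization `std(T)` of a length-`n` tableau, a tableau of length `t = Σ|c_j|`. -/
def stdT {r : ℕ} (n : ℕ) (T : ℕ → GP r) : ℕ → GP r := fun k =>
  if stdIdx n T k = n then T n
  else oscStep (T (stdIdx n T k)) (T (stdIdx n T k + 1)) (k - cum T (stdIdx n T k))

/-- Rows of the promotion–evacuation growth diagram: `PE t S u` is `P^u(S)`
for a length-`t` (oscillating) tableau `S`. -/
def PE {r : ℕ} (t : ℕ) (S : ℕ → GP r) (u : ℕ) : ℕ → GP r := (promo t)^[u] S

/-- `i ∈ {1,…,r-1}` is recorded at cell `(u,v)` of the growth diagram of `S`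
(rows 1-indexed; `λ^{u,v} = P^u(S)(v-u)`). -/
def recorded (r t : ℕ) (S : ℕ → GP r) (i u v : ℕ) : Prop :=
  ∃ a b : Fin r,
    (PE t S (u - 1) (v - u) = PE t S u (v - u - 1) + eV a ∧
     PE t S (u - 1) (v - u + 1) = PE t S u (v - u) + eV b ∧
     (a : ℕ) < i ∧ i ≤ (b : ℕ))
    ∨
    (PE t S u (v - u - 1) = PE t S (u - 1) (v - u) + eV a ∧
     PE t S u (v - u) = PE t S (u - 1) (v - u + 1) + eV b ∧
     (b : ℕ) < i ∧ i ≤ (a : ℕ))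

/-- `i ∈ PM(T)_{u,v}` for an off-diagonal entry of the promotion matrix of `T`
(`u, v ∈ {1,…,t}`, `1 ≤ i ≤ r-1`), using the oscillization `std(T)`. -/
def PMmem (r n t : ℕ) (T : ℕ → GP r) (i u v : ℕ) : Prop :=
  1 ≤ u ∧ u ≤ t ∧ 1 ≤ v ∧ v ≤ t ∧ u ≠ v ∧ 1 ≤ i ∧ i ≤ r - 1 ∧
    recorded r t (stdT n T) i u (if u < v then v else v + t)

/-- Graph of the partial promotion function `prom_i(T)`: `prom_i(T)(u) = v`.
By convention `prom_0 = prom_r = id` on `{1,…,t}`. -/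
def promRel (r n t : ℕ) (T : ℕ → GP r) (i u v : ℕ) : Prop :=
  if i = 0 ∨ i = r then 1 ≤ u ∧ u ≤ t ∧ u = v else PMmem r n t T i u v

/-- Sum of the first `i` entries (1-indexed prefix sums). -/
def pSum {r : ℕ} (v : GP r) (i : ℕ) : ℤ :=
  ∑ j ∈ Finset.univ.filter (fun j : Fin r => (j : ℕ) < i), v j

/-- The filled oscillized local-rule grid: row index `k` counts down from the top row
(`k = 0` is `std(λ → ν)`), column index `q` goes right; the left column is
`std(κ → λ)` read so that `grid cA κ λ ν k 0 = std(κ→λ)` at position `cA - k`. -/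
def grid {r : ℕ} (cA : ℕ) (κ lam ν : GP r) : ℕ → ℕ → GP r
  | 0, q => oscStep lam ν q
  | k + 1, 0 => oscStep κ lam (cA - (k + 1))
  | k + 1, q + 1 =>
      sortDesc (grid cA κ lam ν k (q + 1) + grid cA κ lam ν (k + 1) q -
        grid cA κ lam ν k q)
  termination_by k q => (k, q)

/-- 1-indexed entry of a vector (0 if out of range). -/
def ent {r : ℕ} (v : GP r) (h : ℕ) : ℤ := if hh : h - 1 < r then v ⟨h - 1, hh⟩ else 0

/-- The chain `j_0 = 1, j_h = ` least `h`-balance point of the lattice word of `T`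
weakly after `j_{h-1}` (in `{1,…,n}`), `none` once undefined. An index `j` is an
`h`-balance point iff `(T j)_h = (T j)_{h+1}` (1-indexed rows). -/
def jChain (r n : ℕ) (T : ℕ → GP r) : ℕ → Option ℕ
  | 0 => some 1
  | h + 1 =>
    match jChain r n T h with
    | none => none
    | some jp =>
      if H : ∃ j, jp ≤ j ∧ j ≤ n ∧ ent (T j) (h + 1) = ent (T j) (h + 2) then
        some (Nat.find H)
      else none

/-- `k`: the largest `h ≤ r-1` such that `j_1, …, j_h` are all defined. -/
def kVal (r n : ℕ) (T : ℕ → GP r) : ℕ :=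
  ((Finset.range r).filter fun h => (jChain r n T h).isSome).sup id

/-- `j_h`, defaulting to `0` when undefined. -/
def jval (r n : ℕ) (T : ℕ → GP r) (h : ℕ) : ℕ := (jChain r n T h).getD 0

/-- `ω_c` for `c ∈ {0,±1,…,±r}`: top-justified column of `c` ones if `c ≥ 0`,
bottom-justified column of `|c|` minus-ones if `c < 0`. -/
def omegaGP (r : ℕ) (c : ℤ) : GP r := fun i =>
  if 0 ≤ c then (if (i : ℕ) < c.natAbs then 1 else 0)
  else (if r - c.natAbs ≤ (i : ℕ) then -1 else 0)

/-- The extremal fluctuating tableau of type `c`: partial sums of the `ω_{c_j}`. -/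
def extremal (r : ℕ) (c : ℕ → ℤ) (k : ℕ) : GP r := ∑ j ∈ Finset.range k, omegaGP r (c j)

/-- Lexicographic order: the first nonzero entry of `β - α` is positive. -/
def ltLex {r : ℕ} (α β : GP r) : Prop := ∃ i : Fin r, (∀ j, j < i → α j = β j) ∧ α i < β i

/-- Cumulative sums of `|c_j|` (block boundaries). -/
def cumC (c : ℕ → ℤ) (j : ℕ) : ℕ := ∑ j' ∈ Finset.range j, (c j').natAbs

/-- Entry `(u,v)` (for `u,v ∈ {1,…,n}`) of the reduced promotion matrix `PMr^i(T)`: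
the number of cells in the block `B_u × B_v` whose promotion-matrix entry contains `i`. -/
def PMr (r n t : ℕ) (T : ℕ → GP r) (c : ℕ → ℤ) (i u v : ℕ) : ℕ :=
  (((Finset.Icc (cumC c (u - 1) + 1) (cumC c u)) ×ˢ
    (Finset.Icc (cumC c (v - 1) + 1) (cumC c v))).filter
      fun p => PMmem r n t T i p.1 p.2).card

/-- The set of `r`-row fluctuating tableaux of length `n`, shape `lam`, type `c`,
in bundled (finitely-indexed) form. -/
def FTset (r n : ℕ) (lam : GP r) (c : Fin n → ℤ) : Set (Fin (n + 1) → GP r) :=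
  {T | (∀ k, Antitone (T k)) ∧ T 0 = 0 ∧ T (Fin.last n) = lam ∧
       ∀ j : Fin n, colStep r (c j) (T j.castSucc) (T j.succ)}


/-! ### Basic facts on vectors and sorting -/

lemma add_smul_eV_apply {r : ℕ} (κ : GP r) (ε : ℤ) (a i : Fin r) :
    (κ + ε • eV a) i = κ i + if i = a then ε else 0 := by
  by_cases h : i = a <;> simp [eV, h]

lemma sortDesc_eq_of_perm {r : ℕ} {α β : GP r} (hβ : Antitone β) (σ : Equiv.Perm (Fin r))
    (h : ∀ i, α (σ i) = β i) : sortDesc α = β := by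
  have h1 : Monotone (α ∘ Tuple.sort α) := Tuple.monotone_sort α
  have h2 : Monotone (α ∘ (Fin.revPerm.trans σ : Equiv.Perm (Fin r))) := by
    intro i j hij
    simp only [Function.comp, Equiv.trans_apply, Fin.revPerm_apply, h]
    exact hβ (Fin.rev_le_rev.mpr hij)
  have h3 := Tuple.unique_monotone h1 h2
  funext i
  have := congrFun h3 i.rev
  simpa [sortDesc, h] using this

lemma eV_inj {r : ℕ} {ε ε' : ℤ} {a a' : Fin r} (hε : ε = 1 ∨ ε = -1)
    (h : ε • eV a = ε' • eV a') : ε = ε' ∧ a = a' := by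
  have h1 := congrFun h a
  simp only [eV, Pi.smul_apply, smul_eq_mul, if_true] at h1
  split_ifs at h1 with h2
  · exact ⟨by omega, h2⟩
  · omega

/-- Sorting after adding or removing one box moves the box inside its block. -/
lemma sort_step {r : ℕ} {κ : GP r} (hκ : Antitone κ) {σ : ℤ} (hσ : σ = 1 ∨ σ = -1) (a : Fin r) :
    ∃ b : Fin r, sortDesc (κ + σ • eV a) = κ + σ • eV b ∧ Antitone (κ + σ • eV b) ∧
      κ b = κ a ∧ (σ = 1 → b ≤ a) ∧ (σ = -1 → a ≤ b) := by
  set S := Finset.univ.filter (fun i : Fin r => κ i = κ a) with hS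
  have hne : S.Nonempty := ⟨a, by simp [hS]⟩
  have key : ∀ b : Fin r, κ b = κ a → Antitone (κ + σ • eV b) →
      sortDesc (κ + σ • eV a) = κ + σ • eV b := by
    intro b hb hanti
    refine sortDesc_eq_of_perm hanti (Equiv.swap a b) ?_
    intro i
    rw [add_smul_eV_apply, add_smul_eV_apply]
    by_cases h1 : i = a
    · subst h1
      rw [Equiv.swap_apply_left]
      by_cases h2 : b = i
      · simp [h2]
      · simp [h2, hb, Ne.symm h2]
    · by_cases h2 : i = b
      · subst h2
        rw [Equiv.swap_apply_right]
        simp [hb]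
      · rw [Equiv.swap_apply_of_ne_of_ne h1 h2]
        simp [h1, h2]
  rcases hσ with hσ | hσ
  · have hm := S.min'_mem hne
    set b := S.min' hne with hbdef
    have hb : κ b = κ a := by simpa [hS] using hm
    have hba : b ≤ a := S.min'_le a (by simp [hS])
    have hmin : ∀ i, κ i = κ a → b ≤ i := fun i hi => S.min'_le i (by simp [hS, hi])
    have hanti : Antitone (κ + σ • eV b) := by
      intro i j hij
      rw [add_smul_eV_apply, add_smul_eV_apply]
      have := hκ hij
      have h3 : j = b → i ≠ b → κ j < κ i := by
        intro h1 h2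
        refine lt_of_le_of_ne this fun h4 => h2 (le_antisymm (h1 ▸ hij) (hmin i ?_))
        rw [← h4, h1, hb]
      by_cases hj : j = b <;> by_cases hi : i = b
      · simp_all
      · have := h3 hj hi
        simp only [hj, hi, if_true, if_false]
        rw [hj] at this
        omega
      · simp only [hj, hi, if_true, if_false]
        rw [hi] at this
        omega
      · simp only [hj, hi, if_false]
        omega
    exact ⟨b, key b hb hanti, hanti, hb, fun _ => hba, fun h => by omega⟩
  · have hm := S.max'_mem hne
    set b := S.max' hne with hbdef
    have hb : κ b = κ a := by simpa [hS] using hm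
    have hba : a ≤ b := S.le_max' a (by simp [hS])
    have hmax : ∀ i, κ i = κ a → i ≤ b := fun i hi => S.le_max' i (by simp [hS, hi])
    have hanti : Antitone (κ + σ • eV b) := by
      intro i j hij
      rw [add_smul_eV_apply, add_smul_eV_apply]
      have := hκ hij
      have h3 : i = b → j ≠ b → κ j < κ i := by
        intro h1 h2
        refine lt_of_le_of_ne this fun h4 => h2 (le_antisymm (hmax j ?_) (h1 ▸ hij))
        rw [h4, h1, hb]
      by_cases hj : j = b <;> by_cases hi : i = b
      · simp_all
      · simp only [hj, hi, if_true, if_false]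
        rw [hj] at this
        omega
      · have := h3 hi hj
        simp only [hj, hi, if_true, if_false]
        rw [hi] at this
        omega
      · simp only [hj, hi, if_false]
        omega
    exact ⟨b, key b hb hanti, hanti, hb, fun h => by omega, fun _ => hba⟩

/-- A unit square of a growth diagram, with bottom-left corner `κ`, top-left corner `lam`,
bottom-right corner `μ` and top-right corner `ν`. -/
def Sq {r : ℕ} (κ lam μ ν : GP r) : Prop :=
  ∃ (ε δ : ℤ) (a b d d' : Fin r), (ε = 1 ∨ ε = -1) ∧ (δ = 1 ∨ δ = -1) ∧
    lam = κ + ε • eV a ∧ ν = μ + ε • eV b ∧ μ = κ + δ • eV d' ∧ ν = lam + δ • eV d ∧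
    ν a = ν b ∧ (ε = 1 → a ≤ b) ∧ (ε = -1 → b ≤ a)

/-- Either both box pairs are unchanged, or they are exchanged. -/
lemma box_exchange {r : ℕ} {ε δ : ℤ} {a b d d' : Fin r} (hε : ε = 1 ∨ ε = -1)
    (hδ : δ = 1 ∨ δ = -1)
    (h : ∀ i, (if i = a then ε else 0) + (if i = d then δ else 0)
      = (if i = d' then δ else 0) + (if i = b then ε else 0)) :
    (a = b ∧ d = d') ∨ (ε = δ ∧ a = d' ∧ b = d) ∨ (ε = -δ ∧ a = d ∧ b = d') := by
  have ha := h a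
  have hb := h b
  have hd := h d
  have hd' := h d'
  grind

lemma Sq.box {r : ℕ} {κ lam μ ν : GP r} {ε δ : ℤ} {a b d d' : Fin r}
    (h1 : lam = κ + ε • eV a) (h2 : ν = μ + ε • eV b) (h3 : μ = κ + δ • eV d')
    (h4 : ν = lam + δ • eV d) (hε : ε = 1 ∨ ε = -1) (hδ : δ = 1 ∨ δ = -1) :
    (a = b ∧ d = d') ∨ (ε = δ ∧ a = d' ∧ b = d) ∨ (ε = -δ ∧ a = d ∧ b = d') := by
  apply box_exchange hε hδ
  intro i
  have e1 := congrFun h1 i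
  have e2 := congrFun h2 i
  have e3 := congrFun h3 i
  have e4 := congrFun h4 i
  rw [add_smul_eV_apply] at e1 e2 e3 e4
  linarith

lemma Sq.symm {r : ℕ} {κ lam μ ν : GP r} (h : Sq κ lam μ ν) : Sq κ μ lam ν := by
  obtain ⟨ε, δ, a, b, d, d', hε, hδ, h1, h2, h3, h4, h5, h6, h7⟩ := h
  refine ⟨δ, ε, d', d, b, a, hδ, hε, h3, h4, h1, h2, ?_⟩
  rcases Sq.box h1 h2 h3 h4 hε hδ with ⟨rfl, rfl⟩ | ⟨rfl, rfl, rfl⟩ | ⟨h8, rfl, rfl⟩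
  · exact ⟨rfl, fun _ => le_rfl, fun _ => le_rfl⟩
  · exact ⟨h5, h6, h7⟩
  · exact ⟨h5.symm, fun h => h7 (by omega), fun h => h6 (by omega)⟩

lemma Sq.of_rule {r : ℕ} {κ lam ν : GP r} (hκ : Antitone κ) (hν : Antitone ν)
    {ε δ : ℤ} {a d : Fin r} (hε : ε = 1 ∨ ε = -1) (hδ : δ = 1 ∨ δ = -1)
    (h1 : lam = κ + ε • eV a) (h2 : ν = lam + δ • eV d) :
    Sq κ lam (sortDesc (ν + κ - lam)) ν ∧ Antitone (sortDesc (ν + κ - lam)) := by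
  have e1 : ν + κ - lam = κ + δ • eV d := by rw [h2]; abel
  have e2 : ν + κ - lam = ν + (-ε) • eV a := by rw [h1, neg_smul]; abel
  obtain ⟨d', g1, g2, -, -, -⟩ := sort_step hκ hδ d
  obtain ⟨b, k1, k2, k3, k4, k5⟩ := sort_step hν (σ := -ε) (by omega) a
  rw [← e1] at g1
  rw [← e2] at k1
  refine ⟨⟨ε, δ, a, b, d, d', hε, hδ, h1, ?_, g1, h2, k3.symm, fun h => k5 (by omega),
    fun h => k4 (by omega)⟩, g1 ▸ g2⟩
  rw [k1, neg_smul]; abel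

/-! ### Chains of subsets and the raising operators -/

/-- Weakly decreasing chains of `k`-subsets of the rows, encoded by their prefix counts. -/
def CChain (r : ℕ) (k : ℤ) (c : ℕ → ℕ → ℤ) : Prop :=
  (∀ s, c s 0 = 0) ∧ (∀ s, c s r = k) ∧
  (∀ s m, c s m ≤ c s (m + 1) ∧ c s (m + 1) ≤ c s m + 1) ∧ ∀ s m, c s m ≤ c (s + 1) m

/-- Pairing of a vector with the indicator of the subset with prefix counts `c`. -/
def pair {r : ℕ} (x : GP r) (c : ℕ → ℤ) : ℤ := ∑ d : Fin r, x d * (c ((d : ℕ) + 1) - c d)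

/-- The value of a chain along a path. -/
def cval {r : ℕ} (N : ℕ) (q : ℕ → GP r) (c : ℕ → ℕ → ℤ) : ℤ :=
  ∑ s ∈ Finset.range N, pair (q (s + 1) - q s) (c s)

/-- Every chain value along `q` is bounded by a chain value along `q'`. -/
def CDom (r N : ℕ) (k : ℤ) (q q' : ℕ → GP r) : Prop :=
  ∀ c, CChain r k c → ∃ c', CChain r k c' ∧ cval N q c ≤ cval N q' c'

lemma CDom.trans {r N : ℕ} {k : ℤ} {q q' q'' : ℕ → GP r} (h : CDom r N k q q')
    (h' : CDom r N k q' q'') : CDom r N k q q'' := by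
  intro c hc
  obtain ⟨c', hc', h1⟩ := h c hc
  obtain ⟨c'', hc'', h2⟩ := h' c' hc'
  exact ⟨c'', hc'', h1.trans h2⟩

lemma CDom.of_steps {r N : ℕ} {k : ℤ} {q q' : ℕ → GP r}
    (h : ∀ s < N, q (s + 1) - q s = q' (s + 1) - q' s) : CDom r N k q q' := by
  intro c hc
  refine ⟨c, hc, le_of_eq ?_⟩
  unfold cval
  apply Finset.sum_congr rfl
  intro s hs
  rw [h s (Finset.mem_range.mp hs)]

lemma pair_add {r : ℕ} (x y : GP r) (c : ℕ → ℤ) : pair (x + y) c = pair x c + pair y c := by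
  unfold pair
  rw [← Finset.sum_add_distrib]
  exact Finset.sum_congr rfl fun d _ => by simp [add_mul]

lemma pair_neg {r : ℕ} (x : GP r) (c : ℕ → ℤ) : pair (-x) c = - pair x c := by
  unfold pair
  rw [← Finset.sum_neg_distrib]
  exact Finset.sum_congr rfl fun d _ => by simp

lemma pair_sub {r : ℕ} (x y : GP r) (c : ℕ → ℤ) : pair (x - y) c = pair x c - pair y c := by
  rw [sub_eq_add_neg, pair_add, pair_neg, sub_eq_add_neg]

lemma pair_eV {r : ℕ} (a : Fin r) (c : ℕ → ℤ) : pair (eV a) c = c ((a : ℕ) + 1) - c a := by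
  unfold pair eV
  simp

lemma pair_bump {r : ℕ} (x : GP r) (c c' : ℕ → ℤ) (i : ℕ) (hi : i + 1 < r)
    (h : ∀ m, c' m = c m + if m = i + 1 then 1 else 0) :
    pair x c' = pair x c + (x ⟨i, by omega⟩ - x ⟨i + 1, hi⟩) := by
  have e : ∀ d : Fin r, x d * (c' ((d : ℕ) + 1) - c' d) = x d * (c ((d : ℕ) + 1) - c d) +
      ((if d = ⟨i, by omega⟩ then x d else 0) - (if d = ⟨i + 1, hi⟩ then x d else 0)) := by
    intro d
    rw [h, h]
    simp only [Fin.ext_iff]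
    split_ifs <;> first | omega | ring
  unfold pair
  rw [Finset.sum_congr rfl fun d _ => e d, Finset.sum_add_distrib, Finset.sum_sub_distrib]
  simp

/-- Chain values do not decrease under a raising operator. -/
lemma CDom.raise {r N : ℕ} {k : ℤ} {q q' : ℕ → GP r} (i : ℕ) (hi : i + 1 < r) (j : ℕ) (hj : j < N)
    (hq1 : ∀ s, s ≤ j → q' s = q s)
    (hq2 : ∀ s, j < s → s ≤ N → q' s = q s + (eV ⟨i, by omega⟩ - eV ⟨i + 1, hi⟩))
    (h1 : q j ⟨i, by omega⟩ ≤ q j ⟨i + 1, hi⟩)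
    (h2 : ∀ s, j < s → s ≤ N → q s ⟨i + 1, hi⟩ ≤ q s ⟨i, by omega⟩ + 1) :
    CDom r N k q q' := by
  intro c hc
  obtain ⟨c0, cr, cl, cm⟩ := hc
  set α : GP r := eV ⟨i, by omega⟩ - eV ⟨i + 1, hi⟩ with hα
  have hpα : ∀ g : ℕ → ℤ, pair α g = (g (i + 1) - g i) - (g (i + 2) - g (i + 1)) := by
    intro g
    rw [hα, pair_sub, pair_eV, pair_eV]
  have stlt : ∀ s, s < j → q' (s + 1) - q' s = q (s + 1) - q s := by
    intro s hs
    rw [hq1 _ hs, hq1 _ hs.le]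
  have steq : q' (j + 1) - q' j = (q (j + 1) - q j) + α := by
    rw [hq1 _ le_rfl, hq2 _ (Nat.lt_succ_self j) hj]; abel
  have stgt : ∀ s, j < s → s < N → q' (s + 1) - q' s = q (s + 1) - q s := by
    intro s hs hs'
    rw [hq2 _ hs hs'.le, hq2 _ (by omega) hs']; abel
  by_cases hU : c j (i + 1) = c j i ∧ c j (i + 2) = c j i + 1
  swap
  · refine ⟨c, ⟨c0, cr, cl, cm⟩, ?_⟩
    unfold cval
    apply Finset.sum_le_sum
    intro s hs
    have hs := Finset.mem_range.mp hs
    rcases lt_trichotomy s j with h | h | h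
    · rw [stlt s h]
    · subst h
      rw [steq, pair_add, hpα]
      have a1 := cl s i
      have a2 := cl s (i + 1)
      have : i + 1 + 1 = i + 2 := rfl
      rw [this] at a2
      omega
    · rw [stgt s h hs]
  set U : ℕ → Prop := fun s => c s (i + 1) = c s i ∧ c s (i + 2) = c s i + 1 with hUdef
  set R : ℕ → Prop := fun s => j ≤ s ∧ ∀ s', j ≤ s' → s' ≤ s → U s' with hRdef
  set c' : ℕ → ℕ → ℤ := fun s m => c s m + if R s ∧ m = i + 1 then 1 else 0 with hc'
  have RU : ∀ s, R s → U s := fun s hs => hs.2 s hs.1 le_rfl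
  have Rj : R j := ⟨le_rfl, fun s' h1 h2 => by
    have : s' = j := le_antisymm h2 h1
    subst this; exact hU⟩
  have Rsucc : ∀ s, R s → U (s + 1) → R (s + 1) := by
    intro s hs hu
    refine ⟨by have := hs.1; omega, fun s' h1 h2 => ?_⟩
    rcases Nat.lt_or_ge s' (s + 1) with h | h
    · exact hs.2 s' h1 (by omega)
    · have : s' = s + 1 := le_antisymm h2 h
      subst this; exact hu
  have Rpred : ∀ s, j ≤ s → R (s + 1) → R s := by
    intro s hs hR
    exact ⟨hs, fun s' h1 h2 => hR.2 s' h1 (by omega)⟩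
  have hchain : CChain r k c' := by
    refine ⟨?_, ?_, ?_, ?_⟩
    · intro s; simp [hc', c0]
    · intro s
      have : r ≠ i + 1 := by omega
      simp [hc', cr, this]
    · intro s m
      have a0 := cl s m
      simp only [hc']
      by_cases hR : R s
      · obtain ⟨u1, u2⟩ := RU s hR
        by_cases e1 : m = i + 1
        · subst e1
          have : i + 1 + 1 = i + 2 := rfl
          simp only [hR, true_and, this, if_true] at a0 ⊢
          rw [if_neg (by omega)]
          omega
        · by_cases e2 : m = i
          · subst e2
            simp only [hR, true_and, if_true]
            rw [if_neg (by omega)]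
            omega
          · rw [if_neg (by omega), if_neg (by omega)]
            omega
      · simp only [hR, false_and, if_false]
        omega
    · intro s m
      have a0 := cm s m
      simp only [hc']
      by_cases hR : R s
      · by_cases e1 : m = i + 1
        · subst e1
          by_cases hR' : R (s + 1)
          · simp only [hR, hR', true_and, if_true]; omega
          · have hnU : ¬ U (s + 1) := fun h => hR' (Rsucc s hR h)
            obtain ⟨u1, u2⟩ := RU s hR
            have b1 := cm s i
            have b2 := cm s (i + 2)
            have b3 := cl (s + 1) i
            have b4 := cl (s + 1) (i + 1)
            have : i + 1 + 1 = i + 2 := rfl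
            rw [this] at b4
            simp only [hR, hR', true_and, false_and, if_true, if_false]
            simp only [hUdef] at hnU
            omega
        · rw [if_neg (by tauto), if_neg (by tauto)]; omega
      · simp only [hR, false_and, if_false]
        split_ifs <;> omega
  have hbump : ∀ x : GP r, ∀ s, R s → pair x (c' s) =
      pair x (c s) + (x ⟨i, by omega⟩ - x ⟨i + 1, hi⟩) := by
    intro x s hR
    apply pair_bump x (c s) (c' s) i hi
    intro m
    simp [hc', hR]
  have hsame : ∀ s, ¬ R s → c' s = c s := by
    intro s hR
    funext m
    simp [hc', hR]
  have hlt : ∀ M, M ≤ j → cval M q' c' = cval M q c := by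
    intro M hM
    unfold cval
    apply Finset.sum_congr rfl
    intro s hs
    have hs := Finset.mem_range.mp hs
    rw [stlt s (by omega), hsame s (fun h => by have := h.1; omega)]
  have key : ∀ M, j + M + 1 ≤ N →
      (R (j + M) → cval (j + M + 1) q' c' - cval (j + M + 1) q c =
        (q (j + M + 1) ⟨i, by omega⟩ - q (j + M + 1) ⟨i + 1, hi⟩) + 1 -
        (q j ⟨i, by omega⟩ - q j ⟨i + 1, hi⟩)) ∧
      cval (j + M + 1) q c ≤ cval (j + M + 1) q' c' := by
    intro M
    induction M with
    | zero =>
      intro hN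
      have e : cval (j + 0 + 1) q' c' - cval (j + 0 + 1) q c =
        (q (j + 0 + 1) ⟨i, by omega⟩ - q (j + 0 + 1) ⟨i + 1, hi⟩) + 1 -
        (q j ⟨i, by omega⟩ - q j ⟨i + 1, hi⟩) := by
        have e1 : cval (j + 0 + 1) q' c' = cval j q' c' + pair (q' (j + 1) - q' j) (c' j) := by
          unfold cval; rw [Nat.add_zero, Finset.sum_range_succ]
        have e2 : cval (j + 0 + 1) q c = cval j q c + pair (q (j + 1) - q j) (c j) := by
          unfold cval; rw [Nat.add_zero, Finset.sum_range_succ]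
        rw [e1, e2, hlt j le_rfl, steq, hbump _ _ Rj, pair_add, hpα]
        obtain ⟨u1, u2⟩ := hU
        have w1 : α ⟨i, by omega⟩ = 1 := by simp [hα, eV]
        have w2 : α ⟨i + 1, hi⟩ = -1 := by simp [hα, eV]
        simp only [Pi.add_apply, Pi.sub_apply, w1, w2, Nat.add_zero]
        omega
      refine ⟨fun _ => e, ?_⟩
      have := h2 (j + 0 + 1) (by omega) hN
      omega
    | succ M ih =>
      intro hN
      obtain ⟨ih1, ih2⟩ := ih (by omega)
      have e1 : cval (j + (M + 1) + 1) q' c' = cval (j + M + 1) q' c' +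
          pair (q (j + M + 1 + 1) - q (j + M + 1)) (c' (j + M + 1)) := by
        rw [← stgt (j + M + 1) (by omega) (by omega)]
        unfold cval; rw [← Finset.sum_range_succ]; rfl
      have e2 : cval (j + (M + 1) + 1) q c = cval (j + M + 1) q c +
          pair (q (j + M + 1 + 1) - q (j + M + 1)) (c (j + M + 1)) := by
        unfold cval; rw [← Finset.sum_range_succ]; rfl
      have e3 : j + (M + 1) = j + M + 1 := rfl
      by_cases hR : R (j + M + 1)
      · have hR' := Rpred (j + M) (by omega) hR
        have e4 := ih1 hR'
        have e : cval (j + (M + 1) + 1) q' c' - cval (j + (M + 1) + 1) q c =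
            (q (j + M + 1 + 1) ⟨i, by omega⟩ - q (j + M + 1 + 1) ⟨i + 1, hi⟩) + 1 -
            (q j ⟨i, by omega⟩ - q j ⟨i + 1, hi⟩) := by
          rw [e1, e2, hbump _ _ hR]
          simp only [Pi.sub_apply]
          omega
        refine ⟨fun _ => e, ?_⟩
        have := h2 (j + M + 1 + 1) (by omega) hN
        omega
      · refine ⟨fun h => absurd h hR, ?_⟩
        rw [e1, e2, hsame _ hR]
        omega
  refine ⟨c', hchain, ?_⟩
  have := (key (N - j - 1) (by omega)).2
  rwa [show j + (N - j - 1) + 1 = N by omega] at this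

lemma pair_mono {r : ℕ} {p : GP r} (hp : Antitone p) {c c' : ℕ → ℤ} (h0 : c 0 = c' 0)
    (hr : c r = c' r) (h : ∀ m ≤ r, c m ≤ c' m) : pair p c ≤ pair p c' := by
  cases r with
  | zero => simp [pair]
  | succ n =>
    have key : ∀ M (hM : M < n + 1), p ⟨M, hM⟩ * (c' (M + 1) - c (M + 1)) ≤
        ∑ d ∈ Finset.range (M + 1), (if hd : d < n + 1 then p ⟨d, hd⟩ else 0) *
          ((c' (d + 1) - c (d + 1)) - (c' d - c d)) := by
      intro M
      induction M with
      | zero => intro hM; simp [h0]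
      | succ M ih =>
        intro hM
        rw [Finset.sum_range_succ, dif_pos hM]
        have h1 := ih (by omega)
        have h2 : p ⟨M + 1, hM⟩ ≤ p ⟨M, by omega⟩ := hp (by simp [Fin.le_def])
        have h3 := h (M + 1) (by omega)
        nlinarith
    have := key n (by omega)
    rw [hr, sub_self, mul_zero, Finset.sum_range] at this
    have e : pair p c' - pair p c = ∑ i : Fin (n + 1), (if hd : (i : ℕ) < n + 1 then p ⟨i, hd⟩ else 0) *
          ((c' (i + 1) - c (i + 1)) - (c' i - c i)) := by
      unfold pair
      rw [← Finset.sum_sub_distrib]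
      refine Finset.sum_congr rfl fun d _ => ?_
      rw [dif_pos d.isLt]
      ring
    omega

/-- Along a dominant path from the origin, chain values are bounded by the final prefix sum. -/
lemma cval_le_of_dominant {r N : ℕ} {k : ℤ} {q : ℕ → GP r} (h0 : q 0 = 0)
    (hq : ∀ s ≤ N, Antitone (q s)) {c : ℕ → ℕ → ℤ} (hc : CChain r k c) :
    cval N q c ≤ pair (q N) (c N) := by
  obtain ⟨c0, cr, cl, cm⟩ := hc
  have : ∀ M ≤ N, cval M q c ≤ pair (q M) (c M) := by
    intro M
    induction M with
    | zero => intro _; rw [h0]; simp [cval, pair]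
    | succ M ih =>
      intro hM
      have e : cval (M + 1) q c = cval M q c + pair (q (M + 1) - q M) (c M) := by
        unfold cval; rw [Finset.sum_range_succ]
      have h1 := ih (by omega)
      have h2 : pair (q (M + 1)) (c M) ≤ pair (q (M + 1)) (c (M + 1)) :=
        pair_mono (hq _ hM) (by rw [c0, c0]) (by rw [cr, cr]) (fun m _ => cm M m)
      rw [e, pair_sub]
      omega
  exact this N le_rfl

/-! ### Strips of squares -/

lemma strip_data {r N : ℕ} {p q : ℕ → GP r} (hN : 0 < N)
    (hsq : ∀ s < N, Sq (q s) (p s) (q (s + 1)) (p (s + 1))) :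
    ∃ (ε : ℤ) (a : ℕ → Fin r), (ε = 1 ∨ ε = -1) ∧ (∀ s ≤ N, p s = q s + ε • eV (a s)) ∧
      ∀ s < N, p (s + 1) (a s) = p (s + 1) (a (s + 1)) ∧ (ε = 1 → a s ≤ a (s + 1)) ∧
        (ε = -1 → a (s + 1) ≤ a s) ∧
        ∃ (δ : ℤ) (d : Fin r), (δ = 1 ∨ δ = -1) ∧ p (s + 1) = p s + δ • eV d := by
  obtain ⟨ε, δ, a0, b, d, d', hε, hδ, h1, -⟩ := hsq 0 hN
  have hex : ∀ s ≤ N, ∃ a : Fin r, p s = q s + ε • eV a := by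
    intro s
    induction s with
    | zero => intro _; exact ⟨a0, h1⟩
    | succ s ih =>
      intro hs
      obtain ⟨a, ha⟩ := ih (by omega)
      obtain ⟨ε', δ', a', b', d, d', hε', hδ', g1, g2, -⟩ := hsq s (by omega)
      have : ε • eV a = ε' • eV a' := by
        rw [ha] at g1; exact add_left_cancel g1
      obtain ⟨rfl, rfl⟩ := eV_inj hε this
      exact ⟨b', g2⟩
  have : Nonempty (Fin r) := ⟨a0⟩
  choose! a ha using hex
  refine ⟨ε, a, hε, ha, fun s hs => ?_⟩
  obtain ⟨ε', δ', a', b', d, d', hε', hδ', g1, g2, g3, g4, g5, g6, g7⟩ := hsq s hs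
  have e1 : ε • eV (a s) = ε' • eV a' := by
    rw [ha s hs.le] at g1; exact add_left_cancel g1
  obtain ⟨rfl, e2⟩ := eV_inj hε e1
  have e3 : ε • eV (a (s + 1)) = ε • eV b' := by
    rw [ha (s + 1) hs] at g2; exact add_left_cancel g2
  obtain ⟨-, e4⟩ := eV_inj hε e3
  rw [e2, e4]
  exact ⟨g5, g6, g7, δ', d, hδ', g4⟩

lemma mono_upto {r N : ℕ} {a : ℕ → Fin r} (h : ∀ s < N, a s ≤ a (s + 1)) :
    ∀ s s', s ≤ s' → s' ≤ N → a s ≤ a s' := by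
  intro s s' hss
  induction hss with
  | refl => intro _; exact le_rfl
  | step hm ih => intro hN; exact (ih (by simp at hN; omega)).trans (h _ (by simp at hN; omega))

lemma anti_upto {r N : ℕ} {a : ℕ → Fin r} (h : ∀ s < N, a (s + 1) ≤ a s) :
    ∀ s s', s ≤ s' → s' ≤ N → a s' ≤ a s := by
  intro s s' hss
  induction hss with
  | refl => intro _; exact le_rfl
  | step hm ih => intro hN; exact (h _ (by simp at hN; omega)).trans (ih (by simp at hN; omega))

lemma sub_eV_apply {r : ℕ} (κ : GP r) (a i : Fin r) :
    (κ - eV a) i = κ i - if i = a then 1 else 0 := rfl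

lemma add_eV_apply {r : ℕ} (κ : GP r) (a i : Fin r) :
    (κ + eV a) i = κ i + if i = a then 1 else 0 := rfl

lemma strip_dom_pos {r N : ℕ} {k : ℤ} {p q : ℕ → GP r} (hp : ∀ s ≤ N, Antitone (p s))
    (hq : ∀ s ≤ N, Antitone (q s)) (a : ℕ → Fin r) (h1 : ∀ s ≤ N, q s = p s - eV (a s))
    (h2 : ∀ s < N, p (s + 1) (a s) = p (s + 1) (a (s + 1)))
    (h3 : ∀ s < N, a s ≤ a (s + 1))
    (h4 : ∀ s < N, ∃ (δ : ℤ) (d : Fin r), (δ = 1 ∨ δ = -1) ∧ p (s + 1) = p s + δ • eV d) :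
    CDom r N k p q := by
  have hmono := mono_upto h3
  set F : ℕ → ℕ → Fin r := fun i s =>
    ⟨min (a s : ℕ) i, lt_of_le_of_lt (min_le_left _ _) (a s).isLt⟩ with hF
  set st : ℕ → ℕ → GP r := fun i s => p s - eV (F i s) with hst
  have hbase : CDom r N k p (st (a 0)) := by
    apply CDom.of_steps
    intro s hs
    have e : ∀ s ≤ N, F (a 0) s = a 0 := by
      intro s hs
      have := hmono 0 s (Nat.zero_le _) hs
      apply Fin.ext
      simp only [hF]
      exact min_eq_right this
    simp only [hst]
    rw [e s hs.le, e (s + 1) hs]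
    abel
  have hstep : ∀ i, (a 0 : ℕ) ≤ i → i + 1 < r → CDom r N k (st i) (st (i + 1)) := by
    intro i hi0 hi
    by_cases hJ : ∃ J, J ≤ N ∧ i < a J
    swap
    · push Not at hJ
      apply CDom.of_steps
      have e : ∀ s ≤ N, F i s = F (i + 1) s := by
        intro s hs
        have := hJ s hs
        apply Fin.ext
        simp only [hF]
        omega
      intro s hs
      simp only [hst]
      rw [e s hs.le, e (s + 1) hs]
    · set J := Nat.find hJ with hJdef
      obtain ⟨hJN, hJa⟩ := Nat.find_spec hJ
      rw [← hJdef] at hJN hJa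
      have hmin : ∀ s, s < J → a s ≤ i := by
        intro s hs
        have := Nat.find_min hJ hs
        push Not at this
        exact this (by omega)
      have hJ0 : J ≠ 0 := by
        intro h
        rw [h] at hJa
        omega
      obtain ⟨j, hj⟩ := Nat.exists_eq_succ_of_ne_zero hJ0
      have hj : J = j + 1 := hj
      rw [hj] at hJN hJa
      have haj : (a j : ℕ) ≤ i := hmin j (by omega)
      apply CDom.raise i hi j (by omega)
      · intro s hs
        have := hmin s (by omega)
        have e : F (i + 1) s = F i s := by
          apply Fin.ext
          simp only [hF]
          omega
        simp only [hst, e]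
      · intro s hs hsN
        have h5 : a (j + 1) ≤ a s := hmono (j + 1) s hs hsN
        have h5 : (a (j + 1) : ℕ) ≤ a s := h5
        have e1 : F (i + 1) s = ⟨i + 1, hi⟩ := by
          apply Fin.ext
          simp only [hF]
          omega
        have e2 : F i s = ⟨i, by omega⟩ := by
          apply Fin.ext
          simp only [hF]
          omega
        simp only [hst, e1, e2]
        abel
      · have e2 : F i j = a j := by
          apply Fin.ext
          simp only [hF]
          omega
        simp only [hst, e2]
        rw [sub_eV_apply, sub_eV_apply]
        have g1 := hp (j + 1) hJN (show a j ≤ ⟨i, by omega⟩ from haj)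
        have g2 := hp (j + 1) hJN (show (⟨i, by omega⟩ : Fin r) ≤ ⟨i + 1, hi⟩ by simp [Fin.le_def])
        have g3 := hp (j + 1) hJN (show (⟨i + 1, hi⟩ : Fin r) ≤ a (j + 1) from hJa)
        have g4 := h2 j (by omega)
        obtain ⟨δ, d, hδ, hd⟩ := h4 j (by omega)
        have g5 := congrFun hd (a j)
        have g6 := congrFun hd ⟨i, by omega⟩
        have g7 := congrFun hd ⟨i + 1, hi⟩
        rw [add_smul_eV_apply] at g5 g6 g7
        have g8 := hq j (by omega) (show a j ≤ ⟨i, by omega⟩ from haj)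
        rw [h1 j (by omega), sub_eV_apply, sub_eV_apply, if_pos rfl] at g8
        by_cases hai : a j = ⟨i, by omega⟩
        · rw [hai] at g8 ⊢
          simp only [Fin.mk.injEq] at g8 g6 g7 ⊢
          rw [if_pos trivial, if_neg (by omega)]
          simp only [Fin.ext_iff] at g5 g6 g7
          split_ifs at g5 g6 g7 <;> omega
        · have hai' : (a j : ℕ) < i := by
            rcases Nat.lt_or_ge (a j) i with h | h
            · exact h
            · exact absurd (Fin.ext (le_antisymm haj h)) hai
          simp only [Fin.ext_iff] at g5 g6 g7 g8 ⊢
          rw [if_neg (by omega)] at g8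
          rw [if_neg (by omega), if_neg (by omega)]
          split_ifs at g5 g6 g7 <;> omega
      · intro s hs hsN
        have h5 : a (j + 1) ≤ a s := hmono (j + 1) s hs hsN
        have h5 : (a (j + 1) : ℕ) ≤ a s := h5
        have e2 : F i s = ⟨i, by omega⟩ := by
          apply Fin.ext
          simp only [hF]
          omega
        simp only [hst, e2]
        rw [sub_eV_apply, sub_eV_apply]
        have g2 := hp s hsN (show (⟨i, by omega⟩ : Fin r) ≤ ⟨i + 1, hi⟩ by simp [Fin.le_def])
        simp
        omega
  have hall : ∀ n, (a 0 : ℕ) + n < r → CDom r N k p (st (a 0 + n)) := by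
    intro n
    induction n with
    | zero => intro _; exact hbase
    | succ n ih =>
      intro h
      exact (ih (by omega)).trans (hstep _ (by omega) h)
  have hlast := hall (r - 1 - a 0) (by have := (a 0).isLt; omega)
  refine hlast.trans (CDom.of_steps ?_)
  have e : ∀ s ≤ N, st (a 0 + (r - 1 - a 0)) s = q s := by
    intro s hs
    rw [h1 s hs]
    simp only [hst]
    congr 2
    apply Fin.ext
    simp only [hF]
    have := (a s).isLt
    omega
  intro s hs
  rw [e s hs.le, e (s + 1) hs]

lemma strip_dom_neg {r N : ℕ} {k : ℤ} {p q : ℕ → GP r} (hp : ∀ s ≤ N, Antitone (p s))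
    (hq : ∀ s ≤ N, Antitone (q s)) (a : ℕ → Fin r) (h1 : ∀ s ≤ N, q s = p s + eV (a s))
    (h2 : ∀ s < N, p (s + 1) (a s) = p (s + 1) (a (s + 1)))
    (h3 : ∀ s < N, a (s + 1) ≤ a s)
    (h4 : ∀ s < N, ∃ (δ : ℤ) (d : Fin r), (δ = 1 ∨ δ = -1) ∧ p (s + 1) = p s + δ • eV d) :
    CDom r N k p q := by
  have hmono := anti_upto h3
  have hr : 0 < r := (Nat.zero_le _).trans_lt (a 0).isLt
  set F : ℕ → ℕ → Fin r := fun i s =>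
    if h : i < r then ⟨max (a s : ℕ) i, max_lt (a s).isLt h⟩ else a s with hF
  set st : ℕ → ℕ → GP r := fun i s => p s + eV (F i s) with hst
  have hFv : ∀ i s, i < r → (F i s : ℕ) = max (a s : ℕ) i := by
    intro i s h
    simp [hF, h]
  have hbase : CDom r N k p (st (a 0)) := by
    apply CDom.of_steps
    intro s hs
    have e : ∀ s ≤ N, F (a 0) s = a 0 := by
      intro s hs
      have := hmono 0 s (Nat.zero_le _) hs
      apply Fin.ext
      rw [hFv _ _ (a 0).isLt]
      exact max_eq_right this
    simp only [hst]
    rw [e s hs.le, e (s + 1) hs]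
    abel
  have hstep : ∀ i, i + 1 ≤ (a 0 : ℕ) → CDom r N k (st (i + 1)) (st i) := by
    intro i hi0
    have hi : i + 1 < r := by have := (a 0).isLt; omega
    have hi' : i < r := by omega
    by_cases hJ : ∃ J, J ≤ N ∧ a J ≤ i
    swap
    · push Not at hJ
      apply CDom.of_steps
      have e : ∀ s ≤ N, F (i + 1) s = F i s := by
        intro s hs
        have := hJ s hs
        apply Fin.ext
        rw [hFv _ _ hi, hFv _ _ hi']
        omega
      intro s hs
      simp only [hst]
      rw [e s hs.le, e (s + 1) hs]
    · set J := Nat.find hJ with hJdef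
      obtain ⟨hJN, hJa⟩ := Nat.find_spec hJ
      rw [← hJdef] at hJN hJa
      have hmin : ∀ s, s < J → i < a s := by
        intro s hs
        have := Nat.find_min hJ hs
        push Not at this
        exact this (by omega)
      have hJ0 : J ≠ 0 := by
        intro h
        rw [h] at hJa
        omega
      obtain ⟨j, hj⟩ := Nat.exists_eq_succ_of_ne_zero hJ0
      have hj : J = j + 1 := hj
      rw [hj] at hJN hJa
      have haj : i + 1 ≤ (a j : ℕ) := hmin j (by omega)
      apply CDom.raise i hi j (by omega)
      · intro s hs
        have := hmin s (by omega)
        have e : F (i + 1) s = F i s := by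
          apply Fin.ext
          rw [hFv _ _ hi, hFv _ _ hi']
          omega
        simp only [hst, e]
      · intro s hs hsN
        have h5 : a s ≤ a (j + 1) := hmono (j + 1) s hs hsN
        have h5 : (a s : ℕ) ≤ a (j + 1) := h5
        have e1 : F (i + 1) s = ⟨i + 1, hi⟩ := by
          apply Fin.ext
          rw [hFv _ _ hi]
          simp only
          omega
        have e2 : F i s = ⟨i, by omega⟩ := by
          apply Fin.ext
          rw [hFv _ _ hi']
          simp only
          omega
        simp only [hst, e1, e2]
        abel
      · have e2 : F (i + 1) j = a j := by
          apply Fin.ext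
          rw [hFv _ _ hi]
          omega
        simp only [hst, e2]
        rw [add_eV_apply, add_eV_apply]
        have g1 := hp (j + 1) hJN (show a (j + 1) ≤ ⟨i, by omega⟩ from hJa)
        have g2 := hp (j + 1) hJN (show (⟨i, by omega⟩ : Fin r) ≤ ⟨i + 1, hi⟩ by simp [Fin.le_def])
        have g3 := hp (j + 1) hJN (show (⟨i + 1, hi⟩ : Fin r) ≤ a j from haj)
        have g4 := h2 j (by omega)
        obtain ⟨δ, d, hδ, hd⟩ := h4 j (by omega)
        have g5 := congrFun hd (a j)
        have g6 := congrFun hd ⟨i, by omega⟩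
        have g7 := congrFun hd ⟨i + 1, hi⟩
        rw [add_smul_eV_apply] at g5 g6 g7
        have g8 := hq j (by omega) (show (⟨i + 1, hi⟩ : Fin r) ≤ a j from haj)
        rw [h1 j (by omega), add_eV_apply, add_eV_apply, if_pos rfl] at g8
        by_cases hai : a j = ⟨i + 1, hi⟩
        · rw [hai]
          simp only [Fin.mk.injEq]
          rw [if_pos trivial, if_neg (by omega)]
          simp only [Fin.ext_iff] at g5 g6 g7
          split_ifs at g5 g6 g7 <;> omega
        · have hai' : i + 1 < (a j : ℕ) := by
            rcases Nat.lt_or_ge (i + 1) (a j) with h | h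
            · exact h
            · exact absurd (Fin.ext (le_antisymm h haj)) hai
          simp only [Fin.ext_iff] at g5 g6 g7 g8 ⊢
          rw [if_neg (by omega)] at g8
          rw [if_neg (by omega), if_neg (by omega)]
          split_ifs at g5 g6 g7 <;> omega
      · intro s hs hsN
        have h5 : a s ≤ a (j + 1) := hmono (j + 1) s hs hsN
        have h5 : (a s : ℕ) ≤ a (j + 1) := h5
        have e2 : F (i + 1) s = ⟨i + 1, hi⟩ := by
          apply Fin.ext
          rw [hFv _ _ hi]
          simp only
          omega
        simp only [hst, e2]
        rw [add_eV_apply, add_eV_apply]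
        have g2 := hp s hsN (show (⟨i, by omega⟩ : Fin r) ≤ ⟨i + 1, hi⟩ by simp [Fin.le_def])
        simp
        omega
  have hall : ∀ n, n ≤ (a 0 : ℕ) → CDom r N k p (st (a 0 - n)) := by
    intro n
    induction n with
    | zero => intro _; exact hbase
    | succ n ih =>
      intro h
      have := hstep (a 0 - (n + 1)) (by omega)
      rw [show (a 0 : ℕ) - (n + 1) + 1 = a 0 - n by omega] at this
      exact (ih (by omega)).trans this
  have hlast := hall (a 0) le_rfl
  refine hlast.trans (CDom.of_steps ?_)
  have e : ∀ s ≤ N, st (a 0 - a 0) s = q s := by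
    intro s hs
    rw [h1 s hs]
    simp only [hst]
    congr 2
    apply Fin.ext
    rw [hFv _ _ (by omega)]
    omega
  intro s hs
  rw [e s hs.le, e (s + 1) hs]

lemma strip_dom {r N : ℕ} {k : ℤ} {p q : ℕ → GP r} (hp : ∀ s ≤ N, Antitone (p s))
    (hq : ∀ s ≤ N, Antitone (q s))
    (hsq : ∀ s < N, Sq (q s) (p s) (q (s + 1)) (p (s + 1))) : CDom r N k p q := by
  rcases Nat.eq_zero_or_pos N with rfl | hN
  · exact CDom.of_steps fun s hs => absurd hs (Nat.not_lt_zero _)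
  obtain ⟨ε, a, hε, h1, h2⟩ := strip_data hN hsq
  rcases hε with rfl | rfl
  · refine strip_dom_pos hp hq a (fun s hs => ?_) (fun s hs => (h2 s hs).1)
      (fun s hs => (h2 s hs).2.1 rfl) (fun s hs => (h2 s hs).2.2.2)
    rw [h1 s hs, one_smul]; abel
  · refine strip_dom_neg hp hq a (fun s hs => ?_) (fun s hs => (h2 s hs).1)
      (fun s hs => (h2 s hs).2.2.1 rfl) (fun s hs => (h2 s hs).2.2.2)
    rw [h1 s hs, neg_smul, one_smul]; abel

/-! ### Rectangles of squares -/

/-- Prefix counts of the first `k` rows. -/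
def firstc (k : ℕ) (m : ℕ) : ℤ := ((min m k : ℕ) : ℤ)

/-- Prefix counts of the last `k` rows. -/
def lastc (r k : ℕ) (m : ℕ) : ℤ := ((m - (r - k) : ℕ) : ℤ)

/-- Total sum. -/
def tot {r : ℕ} (x : GP r) : ℤ := ∑ d, x d

lemma tot_add {r : ℕ} (x y : GP r) : tot (x + y) = tot x + tot y := by
  simp [tot, Finset.sum_add_distrib]

lemma rect_dom {r B : ℕ} {k : ℤ} {Y : ℕ → ℕ → GP r} (A : ℕ)
    (hY : ∀ a ≤ A, ∀ b ≤ B, Antitone (Y a b))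
    (hsq : ∀ a < A, ∀ b < B, Sq (Y a b) (Y (a + 1) b) (Y a (b + 1)) (Y (a + 1) (b + 1))) :
    CDom r B k (Y A) (Y 0) := by
  induction A with
  | zero => exact CDom.of_steps fun _ _ => rfl
  | succ A ih =>
    refine CDom.trans ?_ (ih (fun a ha => hY a (by omega)) (fun a ha => hsq a (by omega)))
    exact strip_dom (hY _ le_rfl) (hY A (by omega)) (hsq A (by omega))

lemma cchain_le {r : ℕ} {k : ℕ} {c : ℕ → ℕ → ℤ} (hc : CChain r k c) (s m : ℕ) (hm : m ≤ r) :
    c s m ≤ firstc k m := by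
  obtain ⟨c0, cr, cl, cm⟩ := hc
  have h1 : ∀ m : ℕ, c s m ≤ m := by
    intro m
    induction m with
    | zero => rw [c0]; simp
    | succ m ih => have := (cl s m).2; push_cast; omega
  have h2 : c s m ≤ k := by
    rw [← cr s]
    exact monotone_nat_of_le_succ (fun m => (cl s m).1) hm
  have := h1 m
  simp only [firstc]
  push_cast
  exact le_min this h2

lemma rect_ineq {r A B k : ℕ} (hk : k ≤ r) {Y : ℕ → ℕ → GP r}
    (hY : ∀ a ≤ A, ∀ b ≤ B, Antitone (Y a b))
    (hsq : ∀ a < A, ∀ b < B, Sq (Y a b) (Y (a + 1) b) (Y a (b + 1)) (Y (a + 1) (b + 1)))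
    (h0 : Y 0 0 = 0) :
    pair (Y A B) (lastc r k) - pair (Y A 0) (lastc r k) ≤ pair (Y 0 B) (firstc k) := by
  have hc : CChain r k (fun _ => lastc r k) := by
    refine ⟨fun s => ?_, fun s => ?_, fun s m => ?_, fun s m => le_rfl⟩ <;> simp only [lastc] <;> omega
  obtain ⟨c', hc', hle⟩ := rect_dom A hY hsq _ hc
  have h1 := cval_le_of_dominant h0 (hY 0 (Nat.zero_le _)) hc'
  have h2 : pair (Y 0 B) (c' B) ≤ pair (Y 0 B) (firstc k) := by
    refine pair_mono (hY 0 (Nat.zero_le _) B le_rfl) ?_ ?_ (fun m hm => cchain_le hc' B m hm)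
    · rw [hc'.1]; simp [firstc]
    · rw [hc'.2.1]; simp [firstc, hk]
  have h3 : ∀ M, cval M (Y A) (fun _ => lastc r k) =
      pair (Y A M) (lastc r k) - pair (Y A 0) (lastc r k) := by
    intro M
    induction M with
    | zero => simp [cval]
    | succ M ih =>
      have : cval (M + 1) (Y A) (fun _ => lastc r k) = cval M (Y A) (fun _ => lastc r k) +
        pair (Y A (M + 1) - Y A M) (lastc r k) := by
        unfold cval; rw [Finset.sum_range_succ]
      rw [this, ih, pair_sub]; ring
  rw [h3] at hle
  omega

lemma Sq.tot {r : ℕ} {κ lam μ ν : GP r} (h : Sq κ lam μ ν) : tot κ + tot ν = tot lam + tot μ := by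
  obtain ⟨ε, δ, a, b, d, d', hε, hδ, h1, h2, h3, h4, -⟩ := h
  have e : ∀ (ε : ℤ) (a : Fin r), FT.tot (ε • eV a) = ε := by
    intro ε a; simp [FT.tot, eV]
  rw [h2, h1, tot_add, tot_add, e, e]; ring

lemma rect_tot {r A B : ℕ} {Y : ℕ → ℕ → GP r}
    (hsq : ∀ a < A, ∀ b < B, Sq (Y a b) (Y (a + 1) b) (Y a (b + 1)) (Y (a + 1) (b + 1)))
    (h0 : Y 0 0 = 0) : tot (Y A B) = tot (Y A 0) + tot (Y 0 B) := by
  have h1 : ∀ a < A, ∀ b ≤ B, tot (Y (a + 1) b) - tot (Y a b) = tot (Y (a + 1) 0) - tot (Y a 0) := by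
    intro a ha b
    induction b with
    | zero => intro _; rfl
    | succ b ih =>
      intro hb
      have := (hsq a ha b hb).tot
      have := ih (by omega)
      omega
  have h2 : ∀ a ≤ A, tot (Y a B) - tot (Y a 0) = tot (Y 0 B) - tot (Y 0 0) := by
    intro a
    induction a with
    | zero => intro _; rfl
    | succ a ih =>
      intro ha
      have := h1 a ha B le_rfl
      have := ih (by omega)
      omega
  have := h2 A le_rfl
  have h3 : tot (Y 0 0) = 0 := by rw [h0]; simp [tot]
  omega

lemma pair_last_first {r k : ℕ} (hk : k ≤ r) (x : GP r) :
    pair x (lastc r k) + pair x (firstc (r - k)) = tot x := by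
  unfold pair tot
  rw [← Finset.sum_add_distrib]
  refine Finset.sum_congr rfl fun d _ => ?_
  rw [← mul_add]
  have : lastc r k (d + 1) - lastc r k d + (firstc (r - k) (d + 1) - firstc (r - k) d) = 1 := by
    simp only [lastc, firstc]; omega
  rw [this, mul_one]

lemma pair_first_succ {r k : ℕ} (hk : k < r) (x : GP r) :
    pair x (firstc (k + 1)) - pair x (firstc k) = x ⟨k, hk⟩ := by
  unfold pair
  rw [← Finset.sum_sub_distrib]
  have : ∀ d : Fin r, x d * (firstc (k + 1) (d + 1) - firstc (k + 1) d) -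
      x d * (firstc k (d + 1) - firstc k d) = if d = ⟨k, hk⟩ then x d else 0 := by
    intro d
    rw [← mul_sub]
    simp only [Fin.ext_iff, firstc]
    split_ifs with h
    · rw [show (((min ((d:ℕ) + 1) (k + 1) : ℕ) : ℤ) - ((min (d:ℕ) (k + 1) : ℕ) : ℤ) -
        (((min ((d:ℕ) + 1) k : ℕ) : ℤ) - ((min (d:ℕ) k : ℕ) : ℤ))) = 1 by omega, mul_one]
    · rw [show (((min ((d:ℕ) + 1) (k + 1) : ℕ) : ℤ) - ((min (d:ℕ) (k + 1) : ℕ) : ℤ) -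
        (((min ((d:ℕ) + 1) k : ℕ) : ℤ) - ((min (d:ℕ) k : ℕ) : ℤ))) = 0 by omega, mul_zero]
  rw [Finset.sum_congr rfl fun d _ => this d]
  simp

lemma pair_const {r k : ℕ} (hk : k ≤ r) {x : GP r} {m : ℤ} (hx : ∀ i, x i = m) :
    pair x (firstc k) = m * k := by
  induction k with
  | zero => simp [pair, firstc]
  | succ k ih =>
    have := pair_first_succ (k := k) hk x
    rw [ih (by omega), hx] at this
    push_cast
    linarith

/-- Duality for a rectangular growth diagram. -/
lemma rect_dual {r A B : ℕ} {Y : ℕ → ℕ → GP r}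
    (hY : ∀ a ≤ A, ∀ b ≤ B, Antitone (Y a b))
    (hsq : ∀ a < A, ∀ b < B, Sq (Y a b) (Y (a + 1) b) (Y a (b + 1)) (Y (a + 1) (b + 1)))
    (h0 : Y 0 0 = 0) {m : ℤ} (hm : ∀ i, Y A B i = m) (i : Fin r) :
    Y 0 B i = m - Y A 0 i.rev := by
  have htot := rect_tot hsq h0
  have key : ∀ k ≤ r, pair (Y 0 B) (firstc k) =
      pair (Y A B) (firstc k) - (tot (Y A 0) - pair (Y A 0) (firstc (r - k))) := by
    intro k hk
    have h1 := rect_ineq hk hY hsq h0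
    have h2 := rect_ineq (Y := fun a b => Y b a) (A := B) (B := A) (k := r - k) (by omega)
      (fun a ha b hb => hY b hb a ha) (fun a ha b hb => (hsq b hb a ha).symm) h0
    have e0 : r - (r - k) = k := by omega
    have e1 := pair_last_first hk (Y A 0)
    have e2 := pair_last_first hk (Y A B)
    have e3 := pair_last_first (k := r - k) (by omega) (Y A B)
    have e4 := pair_last_first (k := r - k) (by omega) (Y 0 B)
    rw [e0] at e3 e4
    have c1 := pair_const hk hm
    have c2 := pair_const (k := r - k) (by omega) hm
    have c3 : tot (Y A B) = m * r := by
      simp [tot, hm]; ring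
    have c4 : m * ((r - k : ℕ) : ℤ) = m * r - m * k := by
      rw [Nat.cast_sub hk]; ring
    omega
  have hi := i.isLt
  have f1 := key i hi.le
  have f2 := key (i + 1) hi
  have g1 := pair_first_succ hi (Y 0 B)
  have g2 := pair_first_succ hi (Y A B)
  have g3 := pair_first_succ (k := r - (i + 1)) (by omega) (Y A 0)
  rw [show r - (i + 1) + 1 = r - (i : ℕ) by omega] at g3
  have e : (⟨r - (i + 1), by omega⟩ : Fin r) = i.rev := by
    apply Fin.ext; simp [Fin.val_rev]
  rw [e] at g3
  rw [hm] at g2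
  have e' : (⟨(i : ℕ), hi⟩ : Fin r) = i := rfl
  rw [e'] at g1
  omega

/-! ### The growth diagram -/

/-- Rectangular oscillating tableaux of length `t`. -/
def Good (r t : ℕ) (m : ℤ) (S : ℕ → GP r) : Prop :=
  S 0 = 0 ∧ (∀ i, S t i = m) ∧ (∀ k ≤ t, Antitone (S k)) ∧
    ∀ k < t, ∃ (δ : ℤ) (d : Fin r), (δ = 1 ∨ δ = -1) ∧ S (k + 1) = S k + δ • eV d

lemma BKseg_out {r : ℕ} (m : ℕ) (S : ℕ → GP r) (k : ℕ) (hk : k = 0 ∨ m < k) :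
    BKseg 1 m S k = S k := by
  induction m with
  | zero => rfl
  | succ m ih =>
    simp only [BKseg, Function.comp, BK]
    rw [if_neg (by omega)]
    exact ih (by omega)

lemma BKseg_in {r : ℕ} (S : ℕ → GP r) (k m : ℕ) (hk : k ≤ m) :
    BKseg 1 m S k = BKseg 1 k S k := by
  induction m with
  | zero => rw [show k = 0 by omega]
  | succ m ih =>
    rcases Nat.lt_or_ge m k with h | h
    · rw [show k = m + 1 by omega]
    · rw [← ih h]
      simp only [BKseg, Function.comp, BK]
      rw [if_neg (by omega)]

lemma promo_out {r t : ℕ} (S : ℕ → GP r) (k : ℕ) (hk : k = 0 ∨ t ≤ k) :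
    promo t S k = S k := by
  apply BKseg_out
  omega

lemma promo_in {r t : ℕ} (S : ℕ → GP r) (k : ℕ) (hk : k + 2 ≤ t) :
    promo t S (k + 1) = sortDesc (S (k + 2) + promo t S k - S (k + 1)) := by
  unfold promo
  rw [BKseg_in S (k + 1) (t - 1) (by omega), BKseg_in S k (t - 1) (by omega)]
  simp only [BKseg, Function.comp, BK]
  rw [if_pos (by omega), BKseg_out _ _ _ (by omega), BKseg_out _ _ (1 + k) (by omega)]
  rw [show 1 + k - 1 = k by omega, show 1 + k + 1 = k + 2 by omega, show 1 + k = k + 1 by omega]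

lemma promo_aux {r t : ℕ} {m : ℤ} {S : ℕ → GP r} (hS : Good r t m S) (k : ℕ) (hk : k + 1 ≤ t) :
    Antitone (promo t S k) ∧ ∃ (ε : ℤ) (a : Fin r), (ε = 1 ∨ ε = -1) ∧
      S (k + 1) = promo t S k + ε • eV a := by
  obtain ⟨h0, hm, ha, hs⟩ := hS
  induction k with
  | zero =>
    rw [promo_out _ _ (Or.inl rfl)]
    exact ⟨ha 0 (Nat.zero_le _), hs 0 hk⟩
  | succ k ih =>
    obtain ⟨h1, ε, a, hε, h2⟩ := ih (by omega)
    obtain ⟨δ, d, hδ, h3⟩ := hs (k + 1) (by omega)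
    have := Sq.of_rule h1 (ha (k + 2) hk) hε hδ h2 h3
    rw [← promo_in S k hk] at this
    obtain ⟨⟨ε', δ', a', b', d, d', hε', hδ', g1, g2, -⟩, hanti⟩ := this
    exact ⟨hanti, ε', b', hε', g2⟩

lemma promo_sq {r t : ℕ} {m : ℤ} {S : ℕ → GP r} (hS : Good r t m S) (k : ℕ) (hk : k + 2 ≤ t) :
    Sq (promo t S k) (S (k + 1)) (promo t S (k + 1)) (S (k + 2)) := by
  obtain ⟨h1, ε, a, hε, h2⟩ := promo_aux hS k (by omega)
  obtain ⟨h0, hm, ha, hs⟩ := hS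
  obtain ⟨δ, d, hδ, h3⟩ := hs (k + 1) (by omega)
  have := Sq.of_rule h1 (ha (k + 2) hk) hε hδ h2 h3
  rw [← promo_in S k hk] at this
  exact this.1

lemma promo_good {r t : ℕ} {m : ℤ} {S : ℕ → GP r} (hS : Good r t m S) :
    Good r t m (promo t S) := by
  refine ⟨?_, ?_, ?_, ?_⟩
  · rw [promo_out _ _ (Or.inl rfl)]; exact hS.1
  · rw [promo_out _ _ (Or.inr le_rfl)]; exact hS.2.1
  · intro k hk
    rcases Nat.lt_or_ge k t with h | h
    · exact (promo_aux hS k h).1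
    · rw [promo_out _ _ (Or.inr h)]; exact hS.2.2.1 k hk
  · intro k hk
    rcases Nat.lt_or_ge (k + 1) t with h | h
    · obtain ⟨ε, δ, a, b, d, d', hε, hδ, h1, h2, h3, -⟩ := promo_sq hS k h
      exact ⟨δ, d', hδ, h3⟩
    · rw [promo_out _ (k + 1) (Or.inr h)]
      exact (promo_aux hS k hk).2

lemma PE_succ {r t : ℕ} (S : ℕ → GP r) (u : ℕ) : PE t S (u + 1) = promo t (PE t S u) := by
  unfold PE
  rw [Function.iterate_succ', Function.comp]

lemma PE_good {r t : ℕ} {m : ℤ} {S : ℕ → GP r} (hS : Good r t m S) (u : ℕ) :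
    Good r t m (PE t S u) := by
  induction u with
  | zero => exact hS
  | succ u ih => rw [PE_succ]; exact promo_good ih

lemma PE_sq {r t : ℕ} {m : ℤ} {S : ℕ → GP r} (hS : Good r t m S) (u k : ℕ) (hk : k + 2 ≤ t) :
    Sq (PE t S (u + 1) k) (PE t S u (k + 1)) (PE t S (u + 1) (k + 1)) (PE t S u (k + 2)) := by
  rw [PE_succ]
  exact promo_sq (PE_good hS u) k hk

lemma PE_dual {r t : ℕ} {m : ℤ} {S : ℕ → GP r} (hS : Good r t m S) (u k : ℕ) (hk : k ≤ t)
    (i : Fin r) : PE t S (u + k) (t - k) i = m - PE t S u k i.rev := by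
  have := rect_dual (A := k) (B := t - k) (Y := fun a b => PE t S (u + (k - a)) (a + b))
    (m := m) ?_ ?_ ?_ ?_ i
  · simpa using this
  · intro a ha b hb
    exact (PE_good hS _).2.2.1 _ (by omega)
  · intro a ha b hb
    have := PE_sq hS (u + (k - (a + 1))) (a + b) (by omega)
    rw [show u + (k - (a + 1)) + 1 = u + (k - a) by omega] at this
    rw [show a + 1 + b = a + b + 1 by omega, show a + (b + 1) = a + b + 1 by omega,
      show a + 1 + (b + 1) = a + b + 2 by omega]
    exact this
  · exact (PE_good hS _).1
  · intro i
    rw [show k + (t - k) = t by omega]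
    exact (PE_good hS _).2.1 i

lemma PE_period {r t : ℕ} {m : ℤ} {S : ℕ → GP r} (hS : Good r t m S) (u k : ℕ) (hk : k ≤ t) :
    PE t S (u + t) k = PE t S u k := by
  funext i
  have h1 := PE_dual hS (u + k) (t - k) (by omega) i
  have h2 := PE_dual hS u k hk i.rev
  rw [show u + k + (t - k) = u + t by omega, show t - (t - k) = k by omega, h2] at h1
  rw [h1]; simp

/-! ### Recorded indices -/

/-- The index `i` is recorded in the given square. -/
def recSq {r : ℕ} (κ lam μ ν : GP r) (i : ℕ) : Prop :=
  ∃ a b : Fin r,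
    (lam = κ + eV a ∧ ν = μ + eV b ∧ (a : ℕ) < i ∧ i ≤ (b : ℕ)) ∨
    (κ = lam + eV a ∧ μ = ν + eV b ∧ (b : ℕ) < i ∧ i ≤ (a : ℕ))

lemma recSq_iff {r : ℕ} {κ lam μ ν : GP r} {ε : ℤ} {a b : Fin r} (hε : ε = 1 ∨ ε = -1)
    (h1 : lam = κ + ε • eV a) (h2 : ν = μ + ε • eV b) (i : ℕ) :
    recSq κ lam μ ν i ↔ (ε = 1 ∧ (a : ℕ) < i ∧ i ≤ (b : ℕ)) ∨
      (ε = -1 ∧ (b : ℕ) < i ∧ i ≤ (a : ℕ)) := by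
  constructor
  · rintro ⟨a', b', ⟨g1, g2, g3, g4⟩ | ⟨g1, g2, g3, g4⟩⟩
    · have e1 : ε • eV a = (1 : ℤ) • eV a' := by
        rw [h1] at g1; rw [one_smul]; exact add_left_cancel g1
      have e2 : ε • eV b = (1 : ℤ) • eV b' := by
        rw [h2] at g2; rw [one_smul]; exact add_left_cancel g2
      obtain ⟨f1, f2⟩ := eV_inj hε e1
      obtain ⟨-, f3⟩ := eV_inj hε e2
      subst f2 f3
      exact Or.inl ⟨f1, g3, g4⟩
    · have e1 : ε • eV a = (-1 : ℤ) • eV a' := by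
        have : κ + ε • eV a = κ + (-1 : ℤ) • eV a' := by
          rw [← h1, neg_smul, one_smul, g1]; abel
        exact add_left_cancel this
      have e2 : ε • eV b = (-1 : ℤ) • eV b' := by
        have : μ + ε • eV b = μ + (-1 : ℤ) • eV b' := by
          rw [← h2, neg_smul, one_smul, g2]; abel
        exact add_left_cancel this
      obtain ⟨f1, f2⟩ := eV_inj hε e1
      obtain ⟨-, f3⟩ := eV_inj hε e2
      subst f2 f3
      exact Or.inr ⟨f1, g3, g4⟩
  · rintro (⟨rfl, g1, g2⟩ | ⟨rfl, g1, g2⟩)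
    · exact ⟨a, b, Or.inl ⟨by rw [h1, one_smul], by rw [h2, one_smul], g1, g2⟩⟩
    · refine ⟨a, b, Or.inr ⟨?_, ?_, g1, g2⟩⟩
      · rw [h1, neg_smul, one_smul]; abel
      · rw [h2, neg_smul, one_smul]; abel

lemma recorded_eq {r t : ℕ} (S : ℕ → GP r) (i u k : ℕ) (hk : 1 ≤ k) :
    recorded r t S i (u + 1) (u + 1 + k) ↔
      recSq (PE t S (u + 1) (k - 1)) (PE t S u k) (PE t S (u + 1) k) (PE t S u (k + 1)) i := by
  unfold recorded recSq
  rw [show u + 1 + k - (u + 1) = k by omega, show u + 1 - 1 = u by omega]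

/-- Complement-and-reverse of a vector. -/
def dualV {r : ℕ} (m : ℤ) (x : GP r) : GP r := fun i => m - x i.rev

lemma dual_step {r : ℕ} {m : ℤ} {x y : GP r} {δ : ℤ} {d : Fin r} (h : y = x + δ • eV d) :
    dualV m x = dualV m y + δ • eV d.rev := by
  funext i
  rw [add_smul_eV_apply]
  simp only [dualV]
  rw [h, add_smul_eV_apply]
  have : i.rev = d ↔ i = d.rev := Fin.rev_eq_iff
  simp only [this]
  split_ifs <;> omega

lemma recSq_dual {r : ℕ} {m : ℤ} {κ lam μ ν : GP r} (h : Sq κ lam μ ν) (i : ℕ) (hi : i < r) :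
    recSq κ lam μ ν i ↔ recSq (dualV m ν) (dualV m lam) (dualV m μ) (dualV m κ) (r - i) := by
  obtain ⟨ε, δ, a, b, d, d', hε, hδ, h1, h2, h3, h4, -⟩ := h
  rw [recSq_iff hε h1 h2, recSq_iff hδ (dual_step h4) (dual_step h3)]
  have hd := d.isLt
  have hd' := d'.isLt
  simp only [Fin.val_rev]
  rcases Sq.box h1 h2 h3 h4 hε hδ with ⟨rfl, rfl⟩ | ⟨rfl, rfl, rfl⟩ | ⟨h8, rfl, rfl⟩ <;> omega

lemma PE_dualV {r t : ℕ} {m : ℤ} {S : ℕ → GP r} (hS : Good r t m S) (u k u' k' : ℕ)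
    (hu : u' = u + k) (hk : k' + k = t) : PE t S u' k' = dualV m (PE t S u k) := by
  funext i
  have := PE_dual hS u k (by omega) i
  rw [hu, show k' = t - k by omega, this]
  rfl

lemma recorded_dual {r t : ℕ} {m : ℤ} {S : ℕ → GP r} (hS : Good r t m S) (i u v : ℕ) (hi : i < r)
    (hu : 1 ≤ u) (huv : u < v) (hv : v < u + t) :
    recorded r t S i u v ↔ recorded r t S (r - i) v (u + t) := by
  obtain ⟨u, rfl⟩ := Nat.exists_eq_add_of_le' hu
  obtain ⟨k, rfl⟩ := Nat.exists_eq_add_of_lt huv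
  rw [show u + 1 + k + 1 = u + 1 + (k + 1) by omega, recorded_eq _ _ _ _ (by omega)]
  have e := recorded_eq (t := t) S (r - i) (u + 1 + k) (t - (k + 1)) (by omega)
  rw [show u + 1 + k + 1 + (t - (k + 1)) = u + 1 + t by omega] at e
  rw [show u + 1 + (k + 1) = u + 1 + k + 1 by omega, e]
  rw [PE_dualV hS u (k + 2) (u + 1 + k + 1) (t - (k + 1) - 1) (by omega) (by omega),
    PE_dualV hS u (k + 1) (u + 1 + k) (t - (k + 1)) (by omega) (by omega),
    PE_dualV hS (u + 1) (k + 1) (u + 1 + k + 1) (t - (k + 1)) (by omega) (by omega),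
    PE_dualV hS (u + 1) k (u + 1 + k) (t - (k + 1) + 1) (by omega) (by omega)]
  exact recSq_dual (PE_sq hS u k (by omega)) i hi

lemma recorded_period {r t : ℕ} {m : ℤ} {S : ℕ → GP r} (hS : Good r t m S) (i u v : ℕ)
    (hu : 1 ≤ u) (huv : u < v) (hv : v < u + t) :
    recorded r t S i (u + t) (v + t) ↔ recorded r t S i u v := by
  obtain ⟨u, rfl⟩ := Nat.exists_eq_add_of_le' hu
  obtain ⟨k, rfl⟩ := Nat.exists_eq_add_of_lt huv
  rw [show u + 1 + k + 1 = u + 1 + (k + 1) by omega, recorded_eq _ _ _ _ (by omega)]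
  have e := recorded_eq (t := t) S i (u + t) (k + 1) (by omega)
  rw [show u + 1 + t = u + t + 1 by omega, show u + 1 + (k + 1) + t = u + t + 1 + (k + 1) by omega,
    e, show u + t + 1 = u + 1 + t by omega, PE_period hS _ _ (by omega),
    PE_period hS _ _ (by omega), PE_period hS _ _ (by omega), PE_period hS _ _ (by omega)]

lemma crossing {N : ℕ} {P : ℕ → Prop} (h : ∀ s < N, P s → P (s + 1)) (h0 : ¬ P 0) (hN : P N) :
    ∃! s, s < N ∧ ¬ P s ∧ P (s + 1) := by
  have hmono : ∀ s s', s ≤ s' → s' ≤ N → P s → P s' := by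
    intro s s' hss
    induction hss with
    | refl => intro _ h; exact h
    | step hm ih => intro hN' hp; exact h _ (by simp at hN'; omega) (ih (by simp at hN'; omega) hp)
  have hex : ∃ s, P s := ⟨N, hN⟩
  have hf := Nat.find_spec hex
  have hle : Nat.find hex ≤ N := Nat.find_min' hex hN
  have hne : Nat.find hex ≠ 0 := fun e => h0 (e ▸ hf)
  obtain ⟨j, hj⟩ := Nat.exists_eq_succ_of_ne_zero hne
  rw [Nat.succ_eq_add_one] at hj
  have hj' : ¬ P j := Nat.find_min hex (by omega)
  rw [hj] at hf
  refine ⟨j, ⟨by omega, hj', hf⟩, ?_⟩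
  rintro s ⟨hs, h1, h2⟩
  rcases lt_trichotomy s j with h3 | h3 | h3
  · exact absurd (hmono (s + 1) j h3 (by omega) h2) hj'
  · exact h3
  · exact absurd (hmono (j + 1) s h3 (by omega) hf) h1

lemma recorded_unique {r t : ℕ} {m : ℤ} {S : ℕ → GP r} (hS : Good r t m S) (ht : 1 ≤ t) (i u : ℕ)
    (hi : 1 ≤ i) (hir : i < r) :
    ∃! s, s < t - 1 ∧ recorded r t S i (u + 1) (u + 1 + (s + 1)) := by
  have hr0 : 0 < r := by omega
  have hg := PE_good hS u
  have hg' := PE_good hS (u + 1)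
  have ht2 : 0 < t - 1 := by
    by_contra hcon
    have : t = 1 := by omega
    subst this
    obtain ⟨δ, d, hδ, h1⟩ := hS.2.2.2 0 (by omega)
    have h2 := hS.2.1
    rw [hS.1] at h1
    have h1 : S 1 = 0 + δ • eV d := h1
    have e0 := h2 ⟨0, hr0⟩
    have e1 := h2 ⟨1, by omega⟩
    have e2 := h2 d
    rw [h1, add_smul_eV_apply] at e0 e1 e2
    simp only [Fin.ext_iff, Pi.zero_apply, if_true] at e0 e1 e2
    split_ifs at e0 e1 <;> omega
  obtain ⟨ε, a, hε, h1, h2⟩ := strip_data (N := t - 1) (p := fun s => PE t S u (s + 1))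
    (q := fun s => PE t S (u + 1) s) ht2 (fun s hs => PE_sq hS u s (by omega))
  have hrec : ∀ s, s < t - 1 → (recorded r t S i (u + 1) (u + 1 + (s + 1)) ↔
      (ε = 1 ∧ (a s : ℕ) < i ∧ i ≤ (a (s + 1) : ℕ)) ∨
      (ε = -1 ∧ (a (s + 1) : ℕ) < i ∧ i ≤ (a s : ℕ))) := by
    intro s hs
    rw [recorded_eq _ _ _ _ (by omega)]
    exact recSq_iff hε (h1 s hs.le) (h1 (s + 1) hs) i
  have p0 := h1 0 (Nat.zero_le _)
  have pN := h1 (t - 1) le_rfl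
  rw [hg'.1] at p0
  have anti0 := hg.2.2.1 1 ht
  have antiN := hg'.2.2.1 (t - 1) (by omega)
  rw [show t - 1 + 1 = t by omega] at pN
  have hc : ∀ j, PE t S (u + 1) (t - 1) j = m - if j = a (t - 1) then ε else 0 := by
    intro j
    have := congrFun pN j
    rw [hg.2.1, add_smul_eV_apply] at this
    omega
  have hb : ∀ j, PE t S u 1 j = if j = a 0 then ε else 0 := by
    intro j
    have := congrFun p0 j
    rw [add_smul_eV_apply] at this
    simpa using this
  rcases hε with rfl | rfl
  · have a0 : (a 0 : ℕ) = 0 := by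
      by_contra hne
      have := anti0 (show (⟨0, hr0⟩ : Fin r) ≤ a 0 by simp [Fin.le_def])
      rw [hb, hb, if_pos rfl, if_neg (by simp [Fin.ext_iff]; omega)] at this
      omega
    have aN : (a (t - 1) : ℕ) = r - 1 := by
      by_contra hne
      have := antiN (show a (t - 1) ≤ (⟨r - 1, by omega⟩ : Fin r) by
        simp only [Fin.le_def]; omega)
      rw [hc, hc, if_pos rfl, if_neg (by simp only [Fin.ext_iff]; omega)] at this
      omega
    have := crossing (N := t - 1) (P := fun s => i ≤ (a s : ℕ))
      (fun s hs h => h.trans ((h2 s hs).2.1 rfl)) (by omega) (by omega)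
    refine (existsUnique_congr fun s => ?_).mp this
    refine and_congr_right fun hs => ?_
    rw [hrec s hs]
    omega
  · have a0 : (a 0 : ℕ) = r - 1 := by
      by_contra hne
      have := anti0 (show a 0 ≤ (⟨r - 1, by omega⟩ : Fin r) by
        simp only [Fin.le_def]; omega)
      rw [hb, hb, if_pos rfl, if_neg (by simp only [Fin.ext_iff]; omega)] at this
      omega
    have aN : (a (t - 1) : ℕ) = 0 := by
      by_contra hne
      have := antiN (show (⟨0, hr0⟩ : Fin r) ≤ a (t - 1) by simp [Fin.le_def])
      rw [hc, hc, if_pos rfl, if_neg (by simp only [Fin.ext_iff]; omega)] at this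
      omega
    have := crossing (N := t - 1) (P := fun s => (a s : ℕ) < i)
      (fun s hs h => lt_of_le_of_lt ((h2 s hs).2.2.1 rfl) h) (by omega)
      (by omega)
    refine (existsUnique_congr fun s => ?_).mp this
    refine and_congr_right fun hs => ?_
    rw [hrec s hs]
    omega

/-- The relation `PMmem` for a rectangular oscillating tableau. -/
def Rel (r t : ℕ) (S : ℕ → GP r) (i u v : ℕ) : Prop :=
  u ≠ v ∧ recorded r t S i u (if u < v then v else v + t)

lemma Rel_dual {r t : ℕ} {m : ℤ} {S : ℕ → GP r} (hS : Good r t m S) (i u v : ℕ)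
    (hir : i < r) (hu : 1 ≤ u) (hut : u ≤ t) (hv : 1 ≤ v) (hvt : v ≤ t) :
    Rel r t S i u v ↔ Rel r t S (r - i) v u := by
  unfold Rel
  rcases lt_trichotomy u v with h | h | h
  · rw [if_pos h, if_neg (by omega), recorded_dual hS i u v hir hu h (by omega)]
    exact and_congr_left fun _ => ⟨fun h => h.symm, fun h => h.symm⟩
  · subst h
    exact ⟨fun h => absurd rfl h.1, fun h => absurd rfl h.1⟩
  · rw [if_neg (by omega), if_pos h, recorded_dual hS i u (v + t) hir hu (by omega) (by omega),
      recorded_period hS _ _ _ hv h (by omega)]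
    exact and_congr_left fun _ => ⟨fun h => h.symm, fun h => h.symm⟩

lemma Rel_unique {r t : ℕ} {m : ℤ} {S : ℕ → GP r} (hS : Good r t m S) (i u : ℕ)
    (hi : 1 ≤ i) (hir : i < r) (hu : 1 ≤ u) (hut : u ≤ t) :
    ∃! v, (1 ≤ v ∧ v ≤ t) ∧ Rel r t S i u v := by
  obtain ⟨u, rfl⟩ := Nat.exists_eq_add_of_le' hu
  obtain ⟨s, ⟨hs, hrec⟩, huniq⟩ := recorded_unique hS (by omega) i u hi hir
  refine ⟨if u + 1 + (s + 1) ≤ t then u + 1 + (s + 1) else u + 1 + (s + 1) - t, ?_, ?_⟩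
  · simp only
    split_ifs with h
    · refine ⟨by omega, by omega, ?_⟩
      rw [if_pos (by omega)]; exact hrec
    · refine ⟨by omega, by omega, ?_⟩
      rw [if_neg (by omega), show u + 1 + (s + 1) - t + t = u + 1 + (s + 1) by omega]
      exact hrec
  · rintro v ⟨⟨hv, hvt⟩, hne, hR⟩
    split_ifs at hR with h
    · have := huniq (v - (u + 1) - 1) ⟨by omega, by
        rwa [show u + 1 + (v - (u + 1) - 1 + 1) = v by omega]⟩
      rw [if_pos (by omega)]; omega
    · have := huniq (v + t - (u + 1) - 1) ⟨by omega, by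
        rwa [show u + 1 + (v + t - (u + 1) - 1 + 1) = v + t by omega]⟩
      rw [if_neg (by omega)]; omega

/-- The main permutation statement for an oscillating tableau. -/
lemma Rel_perm {r t : ℕ} {m : ℤ} {S : ℕ → GP r} (hS : Good r t m S) (i : ℕ)
    (hi : 1 ≤ i) (hir : i < r) :
    ∃ π : Equiv.Perm (Fin t),
      (∀ u v : Fin t, Rel r t S i ((u : ℕ) + 1) ((v : ℕ) + 1) ↔ π u = v) ∧ ∀ u, π u ≠ u := by
  have hfun : ∀ i, 1 ≤ i → i < r → ∃ f : Fin t → Fin t, ∀ u v : Fin t,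
      Rel r t S i ((u : ℕ) + 1) ((v : ℕ) + 1) ↔ f u = v := by
    intro i hi hir
    have : ∀ u : Fin t, ∃ w : Fin t, ∀ v : Fin t,
        Rel r t S i ((u : ℕ) + 1) ((v : ℕ) + 1) ↔ w = v := by
      intro u
      obtain ⟨v, ⟨⟨hv, hvt⟩, hR⟩, huniq⟩ := Rel_unique hS i (u + 1) hi hir (by omega) u.isLt
      refine ⟨⟨v - 1, by omega⟩, fun w => ⟨fun h => ?_, fun h => ?_⟩⟩
      · have := huniq (w + 1) ⟨⟨by omega, w.isLt⟩, h⟩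
        apply Fin.ext
        simp only
        omega
      · rw [← h]
        simp only
        rwa [show v - 1 + 1 = v by omega]
    choose f hf using this
    exact ⟨f, hf⟩
  obtain ⟨f, hf⟩ := hfun i hi hir
  obtain ⟨g, hg⟩ := hfun (r - i) (by omega) (by omega)
  have hfg : ∀ u v : Fin t, f u = v ↔ g v = u := by
    intro u v
    rw [← hf, ← hg]
    exact Rel_dual hS i _ _ hir (by omega) u.isLt (by omega) v.isLt
  refine ⟨⟨f, g, fun u => (hfg u _).mp rfl, fun v => (hfg _ v).mpr rfl⟩, hf, fun u hu => ?_⟩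
  exact ((hf u u).mpr hu).1 rfl

/-! ### Oscillization -/

lemma osc_data {r : ℕ} {c : ℤ} {μ lam : GP r} (h : colStep r c μ lam) :
    ∃ (ε : ℤ) (S : Finset (Fin r)) (ρ : Fin r → ℕ), (ε = 1 ∨ ε = -1) ∧ S.card = c.natAbs ∧
      (∀ i, lam i = μ i + if i ∈ S then ε else 0) ∧
      (Finset.univ.filter fun i : Fin r => lam i ≠ μ i) = S ∧
      (∀ j i, oscStep μ lam j i = μ i + if i ∈ S ∧ ρ i ≤ j then ε else 0) ∧
      Set.InjOn ρ S ∧ (∀ i ∈ S, 1 ≤ ρ i ∧ ρ i ≤ S.card) ∧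
      (ε = 1 → ∀ i i', i ≤ i' → ρ i ≤ ρ i') ∧ (ε = -1 → ∀ i i', i ≤ i' → ρ i' ≤ ρ i) := by
  obtain ⟨S, hcard, hif⟩ := h
  split_ifs at hif with hc
  · have hl : ∀ i, lam i = μ i + if i ∈ S then 1 else 0 := fun i => by rw [hif]; rfl
    have hD : (Finset.univ.filter fun i : Fin r => lam i ≠ μ i) = S := by
      ext i
      simp only [Finset.mem_filter, Finset.mem_univ, true_and, hl]
      split_ifs with h <;> simp [h]
    refine ⟨1, S, fun i => (S.filter fun i' => i' ≤ i).card, Or.inl rfl, hcard, hl, hD,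
      ?_, ?_, ?_, ?_, fun h => by omega⟩
    · intro j i
      simp only [oscStep, hD]
      by_cases hi : i ∈ S
      · have : μ i < lam i := by rw [hl, if_pos hi]; omega
        simp only [hi, this, true_and, if_true]
        split_ifs
        · rw [hl, if_pos hi]
        · omega
      · simp [hi]
    · have key : ∀ i i', i' ∈ S → i < i' →
          (S.filter fun x => x ≤ i).card < (S.filter fun x => x ≤ i').card := by
        intro i i' hi' hlt
        apply Finset.card_lt_card
        refine ⟨fun x hx => ?_, fun hsub => ?_⟩
        · simp only [Finset.mem_filter] at hx ⊢
          exact ⟨hx.1, hx.2.trans hlt.le⟩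
        · have := hsub (show i' ∈ S.filter fun x => x ≤ i' by simp [hi'])
          simp only [Finset.mem_filter] at this
          exact absurd hlt (not_lt.mpr this.2)
      intro i hi i' hi' he
      rcases lt_trichotomy i i' with h | h | h
      · exact absurd he (key i i' hi' h).ne
      · exact h
      · exact absurd he (key i' i hi h).ne'
    · intro i hi
      refine ⟨Finset.card_pos.mpr ⟨i, by simp [hi]⟩, Finset.card_le_card (Finset.filter_subset _ _)⟩
    · intro _ i i' hii
      apply Finset.card_le_card
      intro x hx
      simp only [Finset.mem_filter] at hx ⊢
      exact ⟨hx.1, hx.2.trans hii⟩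
  · have hl : ∀ i, lam i = μ i + if i ∈ S then -1 else 0 := fun i => by
      rw [hif]
      simp only [Pi.sub_apply, indV]
      split_ifs <;> omega
    have hD : (Finset.univ.filter fun i : Fin r => lam i ≠ μ i) = S := by
      ext i
      simp only [Finset.mem_filter, Finset.mem_univ, true_and, hl]
      split_ifs with h <;> simp [h]
    refine ⟨-1, S, fun i => (S.filter fun i' => i ≤ i').card, Or.inr rfl, hcard, hl, hD,
      ?_, ?_, ?_, fun h => by omega, ?_⟩
    · intro j i
      simp only [oscStep, hD]
      by_cases hi : i ∈ S
      · have : ¬ μ i < lam i := by rw [hl, if_pos hi]; omega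
        simp only [hi, this, true_and, if_false]
        split_ifs
        · rw [hl, if_pos hi]
        · omega
      · simp [hi]
    · have key : ∀ i i', i ∈ S → i < i' →
          (S.filter fun x => i' ≤ x).card < (S.filter fun x => i ≤ x).card := by
        intro i i' hi' hlt
        apply Finset.card_lt_card
        refine ⟨fun x hx => ?_, fun hsub => ?_⟩
        · simp only [Finset.mem_filter] at hx ⊢
          exact ⟨hx.1, hlt.le.trans hx.2⟩
        · have := hsub (show i ∈ S.filter fun x => i ≤ x by simp [hi'])
          simp only [Finset.mem_filter] at this
          exact absurd hlt (not_lt.mpr this.2)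
      intro i hi i' hi' he
      rcases lt_trichotomy i i' with h | h | h
      · exact absurd he (key i i' hi h).ne'
      · exact h
      · exact absurd he (key i' i hi' h).ne
    · intro i hi
      refine ⟨Finset.card_pos.mpr ⟨i, by simp [hi]⟩, Finset.card_le_card (Finset.filter_subset _ _)⟩
    · intro _ i i' hii
      apply Finset.card_le_card
      intro x hx
      simp only [Finset.mem_filter] at hx ⊢
      exact ⟨hx.1, hii.trans hx.2⟩

lemma osc_facts {r : ℕ} {c : ℤ} {μ lam : GP r} (h : colStep r c μ lam) (hμ : Antitone μ)
    (hlam : Antitone lam) :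
    (Finset.univ.filter fun i : Fin r => lam i ≠ μ i).card = c.natAbs ∧
    oscStep μ lam c.natAbs = lam ∧ (∀ j, Antitone (oscStep μ lam j)) ∧
    ∀ j < c.natAbs, ∃ (δ : ℤ) (d : Fin r), (δ = 1 ∨ δ = -1) ∧
      oscStep μ lam (j + 1) = oscStep μ lam j + δ • eV d := by
  obtain ⟨ε, S, ρ, hε, hcard, hl, hD, ho, hinj, hρ, hm1, hm2⟩ := osc_data h
  rw [hD, ← hcard]
  refine ⟨rfl, ?_, ?_, ?_⟩
  · funext i
    rw [ho, hl]
    by_cases hi : i ∈ S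
    · simp [hi, (hρ i hi).2]
    · simp [hi]
  · intro j i i' hii
    rw [ho, ho]
    have g1 := hμ hii
    have g2 := hlam hii
    rw [hl, hl] at g2
    rcases hε with rfl | rfl
    · have g3 := hm1 rfl i i' hii
      by_cases hi : i ∈ S <;> by_cases hi' : i' ∈ S <;> simp only [hi, hi', true_and, false_and,
        if_true, if_false] at g2 ⊢ <;> (try split_ifs) <;> omega
    · have g3 := hm2 rfl i i' hii
      by_cases hi : i ∈ S <;> by_cases hi' : i' ∈ S <;> simp only [hi, hi', true_and, false_and,
        if_true, if_false] at g2 ⊢ <;> (try split_ifs) <;> omega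
  · intro j hj
    have hsurj : Set.SurjOn ρ S (Finset.Icc 1 S.card) := by
      apply Finset.surjOn_of_injOn_of_card_le
      · intro i hi
        have := hρ i hi
        simp [this.1, this.2]
      · exact hinj
      · simp
    obtain ⟨d, hd, hdj⟩ := hsurj (show j + 1 ∈ ((Finset.Icc 1 S.card : Finset ℕ) : Set ℕ) by
      simp; omega)
    refine ⟨ε, d, hε, ?_⟩
    funext i
    rw [add_smul_eV_apply, ho, ho]
    by_cases hi : i ∈ S
    · have : i = d ↔ ρ i = j + 1 := by
        constructor
        · rintro rfl; exact hdj
        · intro h; exact hinj hi hd (h.trans hdj.symm)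
      simp only [hi, true_and, this]
      split_ifs <;> omega
    · have : i ≠ d := fun h => hi (h ▸ hd)
      simp [hi, this]

lemma osc_zero {r : ℕ} (μ lam : GP r) : oscStep μ lam 0 = μ := by
  funext i
  simp only [oscStep]
  rw [if_neg]
  rintro ⟨hi, h⟩
  split_ifs at h with h1
  · rw [Nat.le_zero, Finset.card_eq_zero] at h
    have : i ∈ (∅ : Finset (Fin r)) := by
      rw [← h, Finset.mem_filter]; exact ⟨hi, le_rfl⟩
    simp at this
  · rw [Nat.le_zero, Finset.card_eq_zero] at h
    have : i ∈ (∅ : Finset (Fin r)) := by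
      rw [← h, Finset.mem_filter]; exact ⟨hi, le_rfl⟩
    simp at this

lemma cum_succ {r : ℕ} (T : ℕ → GP r) (j : ℕ) : cum T (j + 1) = cum T j + stepSize T j := by
  unfold cum; rw [Finset.sum_range_succ]

lemma cum_mono {r : ℕ} (T : ℕ → GP r) : Monotone (cum T) :=
  monotone_nat_of_le_succ fun j => by rw [cum_succ]; omega

lemma stdIdx_spec {r : ℕ} (n : ℕ) (T : ℕ → GP r) (k : ℕ) :
    stdIdx n T k ≤ n ∧ cum T (stdIdx n T k) ≤ k ∧ ∀ j ≤ n, cum T j ≤ k → j ≤ stdIdx n T k := by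
  have hne : ((Finset.range (n + 1)).filter fun j => cum T j ≤ k).Nonempty :=
    ⟨0, by rw [Finset.mem_filter]; simp [cum]⟩
  obtain ⟨j, hj, he⟩ := Finset.exists_mem_eq_sup _ hne id
  have he : stdIdx n T k = j := he
  rw [Finset.mem_filter, Finset.mem_range] at hj
  refine ⟨by omega, by rw [he]; exact hj.2, fun j' hj' hc => ?_⟩
  have : j' ∈ ((Finset.range (n + 1)).filter fun j => cum T j ≤ k) := by
    rw [Finset.mem_filter, Finset.mem_range]; exact ⟨by omega, hc⟩
  exact Finset.le_sup (f := id) this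

lemma stdIdx_eq {r n : ℕ} {T : ℕ → GP r} {k j : ℕ} (hj : j < n) (h1 : cum T j ≤ k)
    (h2 : k < cum T (j + 1)) : stdIdx n T k = j := by
  obtain ⟨g1, g2, g3⟩ := stdIdx_spec n T k
  refine le_antisymm ?_ (g3 j hj.le h1)
  by_contra hlt
  have := cum_mono T (show j + 1 ≤ stdIdx n T k by omega)
  omega

lemma stdT_cum {r n : ℕ} {T : ℕ → GP r} {j : ℕ} (hj : j ≤ n) : stdT n T (cum T j) = T j := by
  obtain ⟨g1, g2, g3⟩ := stdIdx_spec n T (cum T j)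
  have g4 := g3 j hj le_rfl
  have const : ∀ j', j ≤ j' → cum T j' = cum T j → T j' = T j := by
    intro j' hjj
    induction hjj with
    | refl => intro _; rfl
    | @step p hm ih =>
      intro he
      have e1 := cum_succ T p
      have e2 := cum_mono T hm
      have he : cum T (p + 1) = cum T j := he
      have hp : cum T p = cum T j := by
        have : cum T j ≤ cum T p := e2
        omega
      rw [← ih hp]
      have hz : stepSize T p = 0 := by omega
      unfold stepSize at hz
      rw [Finset.card_eq_zero, Finset.filter_eq_empty_iff] at hz
      funext i
      have := hz (Finset.mem_univ i)
      exact not_not.mp this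
  have hc : cum T (stdIdx n T (cum T j)) = cum T j := le_antisymm g2 (cum_mono T g4)
  have hT := const _ g4 hc
  unfold stdT
  split_ifs with h
  · rw [← hT, h]
  · rw [hc, Nat.sub_self, osc_zero, hT]

lemma stdT_good {r n t : ℕ} {T : ℕ → GP r} {c : ℕ → ℤ} (hT : IsFT r n T c) {m : ℤ}
    (hm : ∀ i, T n i = m) (ht : t = ∑ j ∈ Finset.range n, (c j).natAbs) :
    Good r t m (stdT n T) := by
  obtain ⟨⟨hanti, hstep⟩, h0⟩ := hT
  have facts := fun j (hj : j < n) =>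
    osc_facts (hstep j hj) (hanti j hj.le) (hanti (j + 1) hj)
  have hsz : ∀ j < n, stepSize T j = (c j).natAbs := fun j hj => (facts j hj).1
  have htc : t = cum T n := by
    rw [ht]
    unfold cum
    exact Finset.sum_congr rfl fun j hj => (hsz j (Finset.mem_range.mp hj)).symm
  have hidx : ∀ k < t, ∃ j < n, cum T j ≤ k ∧ k < cum T (j + 1) := by
    intro k hk
    obtain ⟨g1, g2, g3⟩ := stdIdx_spec n T k
    have hlt : stdIdx n T k < n := by
      rcases Nat.lt_or_ge (stdIdx n T k) n with h | h
      · exact h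
      · have := cum_mono T h
        omega
    refine ⟨stdIdx n T k, hlt, g2, ?_⟩
    by_contra hcon
    have := g3 (stdIdx n T k + 1) hlt (by omega)
    omega
  have hval : ∀ j < n, ∀ k, cum T j ≤ k → k ≤ cum T (j + 1) →
      stdT n T k = oscStep (T j) (T (j + 1)) (k - cum T j) := by
    intro j hj k h1 h2
    rcases Nat.lt_or_ge k (cum T (j + 1)) with h | h
    · unfold stdT
      rw [stdIdx_eq hj h1 h, if_neg (by omega)]
    · have hk : k = cum T (j + 1) := le_antisymm h2 h
      rw [hk, stdT_cum (by omega), cum_succ, Nat.add_sub_cancel_left, hsz j hj, (facts j hj).2.1]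
  refine ⟨?_, ?_, ?_, ?_⟩
  · have : stdT n T (cum T 0) = T 0 := stdT_cum (Nat.zero_le _)
    rw [h0] at this
    simpa [cum] using this
  · rw [htc, stdT_cum le_rfl]; exact hm
  · intro k hk
    rcases Nat.lt_or_ge k t with h | h
    · obtain ⟨j, hj, h1, h2⟩ := hidx k h
      rw [hval j hj k h1 h2.le]
      exact (facts j hj).2.2.1 _
    · rw [show k = cum T n by omega, stdT_cum le_rfl]; exact hanti n le_rfl
  · intro k hk
    obtain ⟨j, hj, h1, h2⟩ := hidx k hk
    rw [hval j hj k h1 h2.le, hval j hj (k + 1) (by omega) h2,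
      show k + 1 - cum T j = k - cum T j + 1 by omega]
    have := cum_succ T j
    rw [hsz j hj] at this
    exact (facts j hj).2.2.2 _ (by omega)

lemma PMmem_iff {r n t : ℕ} {T : ℕ → GP r} {i : ℕ} (hi : 1 ≤ i) (hir : i ≤ r - 1) (u v : Fin t) :
    PMmem r n t T i ((u : ℕ) + 1) ((v : ℕ) + 1) ↔
      Rel r t (stdT n T) i ((u : ℕ) + 1) ((v : ℕ) + 1) := by
  have hu := u.isLt
  have hv := v.isLt
  constructor
  · rintro ⟨-, -, -, -, h1, -, -, h2⟩
    exact ⟨h1, h2⟩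
  · rintro ⟨h1, h2⟩
    exact ⟨by omega, by omega, by omega, by omega, h1, hi, hir, h2⟩

/-- **Corollary.** Let `T` be an `r`-row rectangular fluctuating tableau with
`t = Σ|c_j| ≥ 1`.  For every `1 ≤ i ≤ r-1`, `prom_i(T)` is a fixed-point-free
permutation of `{1,…,t}`; and if `r` is even, `prom_{r/2}(T)` is moreover a
fixed-point-free involution. -/
theorem promotion_permutations_fixed_point_free
    (r n t : ℕ) (T : ℕ → GP r) (c : ℕ → ℤ)
    (hT : IsFT r n T c) (hrect : Rect r n T)
    (ht : t = ∑ j ∈ Finset.range n, (c j).natAbs) (ht1 : 1 ≤ t) :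
    (∀ i, 1 ≤ i → i ≤ r - 1 →
      ∃ π : Equiv.Perm (Fin t),
        (∀ u v : Fin t, PMmem r n t T i ((u : ℕ) + 1) ((v : ℕ) + 1) ↔ π u = v) ∧
        ∀ u, π u ≠ u) ∧
    (2 ∣ r →
      ∃ π : Equiv.Perm (Fin t),
        (∀ u v : Fin t, PMmem r n t T (r / 2) ((u : ℕ) + 1) ((v : ℕ) + 1) ↔ π u = v) ∧
        (∀ u, π u ≠ u) ∧ π * π = 1) := by
  obtain ⟨m, hm⟩ := hrect
  have hS := stdT_good hT hm ht
  have main : ∀ i, 1 ≤ i → i ≤ r - 1 →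
      ∃ π : Equiv.Perm (Fin t),
        (∀ u v : Fin t, PMmem r n t T i ((u : ℕ) + 1) ((v : ℕ) + 1) ↔ π u = v) ∧
        ∀ u, π u ≠ u := by
    intro i hi hir
    obtain ⟨π, h1, h2⟩ := Rel_perm hS i hi (by omega)
    exact ⟨π, fun u v => (PMmem_iff hi hir u v).trans (h1 u v), h2⟩
  refine ⟨main, fun h2r => ?_⟩
  have hr : 0 < r := by
    obtain ⟨δ, d, -⟩ := hS.2.2.2 0 ht1
    exact (Nat.zero_le _).trans_lt d.isLt
  have hi : 1 ≤ r / 2 := by omega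
  have hir : r / 2 ≤ r - 1 := by omega
  obtain ⟨π, h1, h2⟩ := main (r / 2) hi hir
  refine ⟨π, h1, h2, ?_⟩
  ext u : 1
  have h3 := (PMmem_iff hi hir u (π u)).mp ((h1 u (π u)).mpr rfl)
  have h4 := (Rel_dual hS (r / 2) _ _ (by omega) (by omega) u.isLt (by omega)
    (π u).isLt).mp h3
  rw [show r - r / 2 = r / 2 by omega] at h4
  exact (h1 (π u) u).mp ((PMmem_iff hi hir (π u) u).mpr h4)

end FT
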